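/- arXiv:2407.00032 — 9 statements merged into one kernel-verified Lean document; each statement's English description precedes it below -/
import Mathlib

section
/- Splitting invariance for worker fairness: Let (I,J,E,λ,μ) be a bipartite instance, let j₀ ∈ J and let k be a positive integer. Form a new instance in which j₀ is replaced by k copies j₀¹,…,j₀ᵏ, each copy having exactly the same set of neighboring workers as j₀, the same service rates μ_{i,j₀ʳ} = μ_{i,j₀} for every i ∼ j₀, and arrival rate λ_{j₀ʳ} = λ_{j₀}/k; all other task types, edges, arrival rates and service rates are unchanged. Then the optimal value η_s* of the new instance equals the optimal value η_s* of the original instance. -/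
open Finset

/-- The workload of worker `i` under allocation `x`:
`ρ_i(x) = ∑_{ℓ ∼ i} x_{iℓ} λ_ℓ / μ_{iℓ}`. -/
noncomputable def rho {I J : Type*} [Fintype J] (E : I → J → Prop)
    [∀ i j, Decidable (E i j)] (lam : J → ℝ) (mu : I → J → ℝ)
    (x : I → J → ℝ) (i : I) : ℝ :=
  ∑ l ∈ univ.filter (fun l => E i l), x i l * lam l / mu i l

/-- Feasibility of an allocation `x` for the instance `(I, J, E, λ, μ)`. -/
def Feasible {I J : Type*} [Fintype I] [Fintype J] (E : I → J → Prop)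
    [∀ i j, Decidable (E i j)] (lam : J → ℝ) (mu : I → J → ℝ)
    (x : I → J → ℝ) : Prop :=
  (∀ i j, ¬ E i j → x i j = 0) ∧
  (∀ i j, 0 ≤ x i j ∧ x i j ≤ 1) ∧
  (∀ j, ∑ i ∈ univ.filter (fun i => E i j), x i j = 1) ∧
  (∀ i, rho E lam mu x i ≤ 1)

/-- Strict feasibility: feasibility plus `ρ_i(x) < 1` for every worker. -/
def StrictFeasible {I J : Type*} [Fintype I] [Fintype J] (E : I → J → Prop)
    [∀ i j, Decidable (E i j)] (lam : J → ℝ) (mu : I → J → ℝ)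
    (x : I → J → ℝ) : Prop :=
  Feasible E lam mu x ∧ ∀ i, rho E lam mu x i < 1

/-- Expected relative waiting time of task type `j` under allocation `x`. -/
noncomputable def wbar {I J : Type*} [Fintype I] [Fintype J] (E : I → J → Prop)
    [∀ i j, Decidable (E i j)] (lam : J → ℝ) (mu : I → J → ℝ)
    (x : I → J → ℝ) (j : J) : ℝ :=
  ∑ i ∈ univ.filter (fun i => E i j),
    x i j * mu i j *
      ((∑ l ∈ univ.filter (fun l => E i l), x i l * lam l / (mu i l) ^ 2) /
        (1 - ∑ l ∈ univ.filter (fun l => E i l), x i l * lam l / mu i l))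

/-- Optimal value `η_s*` of Program P_B: the infimum over feasible `x`
of the maximum workload. -/
noncomputable def etaS {I J : Type*} [Fintype I] [Fintype J] (E : I → J → Prop)
    [∀ i j, Decidable (E i j)] (lam : J → ℝ) (mu : I → J → ℝ) : ℝ :=
  sInf ((fun x => ⨆ i, rho E lam mu x i) '' {x | Feasible E lam mu x})

/-- Optimal value `η_t*` of Program P_A: the infimum over strictly feasible `x`
of the maximum relative waiting time. -/
noncomputable def etaT {I J : Type*} [Fintype I] [Fintype J] (E : I → J → Prop)
    [∀ i j, Decidable (E i j)] (lam : J → ℝ) (mu : I → J → ℝ) : ℝ :=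
  sInf ((fun x => ⨆ j, wbar E lam mu x j) '' {x | StrictFeasible E lam mu x})

/-- Optimal value `η̄_t*` of Program P̄_A (the simplified program in the uniform
case): the infimum over strictly feasible `x` of
`max_j ((∑_{i ∼ j} x_{ij}/(1 − ρ_i(x))) − 1)`. -/
noncomputable def etaTbar {I J : Type*} [Fintype I] [Fintype J] (E : I → J → Prop)
    [∀ i j, Decidable (E i j)] (lam : J → ℝ) (mu : I → J → ℝ) : ℝ :=
  sInf ((fun x => ⨆ j,
    (∑ i ∈ univ.filter (fun i => E i j), x i j / (1 - rho E lam mu x i)) - 1) ''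
      {x | StrictFeasible E lam mu x})

/-- **Splitting invariance for worker fairness.** Replacing a task type `j₀` by
`k` copies, each with the same neighborhood and service rates and arrival rate
`λ_{j₀}/k`, leaves the optimal value `η_s*` of Program P_B unchanged. -/
theorem splitting_invariance_worker_fairness
    {I J : Type*} [Fintype I] [Fintype J] [Nonempty I] [Nonempty J] [DecidableEq J]
    (E : I → J → Prop) [∀ i j, Decidable (E i j)]
    (lam : J → ℝ) (mu : I → J → ℝ)
    (hlam : ∀ j, 0 < lam j) (hmu : ∀ i j, E i j → 0 < mu i j)
    (hEj : ∀ j, ∃ i, E i j) (hEi : ∀ i, ∃ j, E i j)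
    (j₀ : J) (k : ℕ) (hk : 0 < k)
    (E' : I → ({j : J // j ≠ j₀} ⊕ Fin k) → Prop) [∀ i j, Decidable (E' i j)]
    (lam' : ({j : J // j ≠ j₀} ⊕ Fin k) → ℝ)
    (mu' : I → ({j : J // j ≠ j₀} ⊕ Fin k) → ℝ)
    (hE'old : ∀ i (j : {j : J // j ≠ j₀}), E' i (Sum.inl j) ↔ E i j.1)
    (hE'new : ∀ i (r : Fin k), E' i (Sum.inr r) ↔ E i j₀)
    (hlam'old : ∀ j : {j : J // j ≠ j₀}, lam' (Sum.inl j) = lam j.1)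
    (hlam'new : ∀ r : Fin k, lam' (Sum.inr r) = lam j₀ / k)
    (hmu'old : ∀ i (j : {j : J // j ≠ j₀}), mu' i (Sum.inl j) = mu i j.1)
    (hmu'new : ∀ i (r : Fin k), mu' i (Sum.inr r) = mu i j₀) :
    etaS E' lam' mu' = etaS E lam mu := by
  have hk' : (k : ℝ) ≠ 0 := by exact_mod_cast hk.ne'
  have hkp : (0 : ℝ) < k := by exact_mod_cast hk
  have key : ∀ (x : I → J → ℝ) (x' : I → ({j : J // j ≠ j₀} ⊕ Fin k) → ℝ),
      (∀ i (j : {j : J // j ≠ j₀}), x' i (Sum.inl j) = x i j.1) →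
      (∀ i, ∑ r, x' i (Sum.inr r) = k * x i j₀) →
      ∀ i, rho E' lam' mu' x' i = rho E lam mu x i := by
    intro x x' h1 h2 i
    unfold rho
    rw [Finset.sum_filter, Finset.sum_filter, Fintype.sum_sum_type,
      Fintype.sum_eq_add_sum_subtype_ne _ j₀, add_comm]
    simp only [hE'old, hE'new, hlam'old, hlam'new, hmu'old, hmu'new, h1]
    congr 1
    split_ifs with h
    · rw [← Finset.sum_div, ← Finset.sum_mul, h2]
      field_simp
    · simp
  have hset : (fun x => ⨆ i, rho E' lam' mu' x i) '' {x | Feasible E' lam' mu' x}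
      = (fun x => ⨆ i, rho E lam mu x i) '' {x | Feasible E lam mu x} := by
    ext v
    constructor
    · rintro ⟨x', ⟨f1, f2, f3, f4⟩, rfl⟩
      let x : I → J → ℝ := fun i j =>
        if h : j = j₀ then (∑ r, x' i (Sum.inr r)) / k else x' i (Sum.inl ⟨j, h⟩)
      have hx0 : ∀ i, x i j₀ = (∑ r, x' i (Sum.inr r)) / k := fun i => by simp [x]
      have hx1 : ∀ i (j : {j : J // j ≠ j₀}), x' i (Sum.inl j) = x i j.1 := fun i j => by
        simp [x, j.2]
      have hr := key x x' hx1 (fun i => by rw [hx0]; field_simp)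
      refine ⟨x, ⟨?_, ?_, ?_, ?_⟩, ?_⟩
      · intro i j hE
        by_cases h : j = j₀
        · subst h
          rw [hx0, Finset.sum_eq_zero, zero_div]
          intro r _
          exact f1 _ _ (by rwa [hE'new])
        · rw [← hx1 i ⟨j, h⟩]
          exact f1 _ _ (by rwa [hE'old])
      · intro i j
        by_cases h : j = j₀
        · subst h
          rw [hx0]
          refine ⟨div_nonneg (Finset.sum_nonneg fun r _ => (f2 _ _).1) hkp.le, ?_⟩
          rw [div_le_one hkp]
          calc ∑ r, x' i (Sum.inr r) ≤ ∑ r : Fin k, (1 : ℝ) :=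
                Finset.sum_le_sum fun r _ => (f2 _ _).2
            _ = k := by simp
        · rw [← hx1 i ⟨j, h⟩]
          exact f2 _ _
      · intro j
        by_cases h : j = j₀
        · subst h
          simp only [hx0]
          rw [← Finset.sum_div, Finset.sum_comm, div_eq_one_iff_eq hk']
          calc _ = ∑ r : Fin k, (1 : ℝ) := by
                refine Finset.sum_congr rfl fun r _ => ?_
                rw [← f3 (Sum.inr r)]
                simp only [hE'new]
            _ = k := by simp
        · rw [← f3 (Sum.inl ⟨j, h⟩)]
          simp only [hE'old, hx1]
      · intro i
        rw [← hr]
        exact f4 i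
      · simp only [hr]
    · rintro ⟨x, ⟨f1, f2, f3, f4⟩, rfl⟩
      let x' : I → ({j : J // j ≠ j₀} ⊕ Fin k) → ℝ := fun i =>
        Sum.elim (fun j => x i j.1) (fun _ => x i j₀)
      have hr := key x x' (fun i j => rfl) (fun i => by simp [x'])
      refine ⟨x', ⟨?_, ?_, ?_, ?_⟩, ?_⟩
      · rintro i (j | r) hE
        · exact f1 _ _ (by rwa [hE'old] at hE)
        · exact f1 _ _ (by rwa [hE'new] at hE)
      · rintro i (j | r)
        · exact f2 _ _
        · exact f2 _ _
      · rintro (j | r)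
        · simp only [hE'old]
          exact f3 _
        · simp only [hE'new]
          exact f3 _
      · intro i
        rw [hr]
        exact f4 i
      · simp only [hr]
  unfold etaS
  rw [hset]
end

section
/- Splitting invariance for task fairness: Let (I,J,E,λ,μ) be a bipartite instance, let j₀ ∈ J and let k be a positive integer. Form a new instance in which j₀ is replaced by k copies j₀¹,…,j₀ᵏ, each copy having exactly the same set of neighboring workers as j₀, the same service rates μ_{i,j₀ʳ} = μ_{i,j₀} for every i ∼ j₀, and arrival rate λ_{j₀ʳ} = λ_{j₀}/k; all other task types, edges, arrival rates and service rates are unchanged. Then the optimal value η_t* of the new instance equals the optimal value η_t* of the original instance. -/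
open Finset

lemma wbar_nonneg_aux {I J : Type*} [Fintype I] [Fintype J] (E : I → J → Prop)
    [∀ i j, Decidable (E i j)] (lam : J → ℝ) (mu : I → J → ℝ)
    (hlam : ∀ j, 0 < lam j) (hmu : ∀ i j, E i j → 0 < mu i j)
    (x : I → J → ℝ) (hx : StrictFeasible E lam mu x) (j : J) :
    0 ≤ wbar E lam mu x j := by
  unfold wbar
  refine Finset.sum_nonneg fun i hi => ?_
  have hi' : E i j := (Finset.mem_filter.1 hi).2
  refine mul_nonneg (mul_nonneg (hx.1.2.1 i j).1 (hmu i j hi').le) (div_nonneg ?_ ?_)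
  · refine Finset.sum_nonneg fun l _ => ?_
    exact div_nonneg (mul_nonneg (hx.1.2.1 i l).1 (hlam l).le) (sq_nonneg _)
  · have := hx.2 i
    unfold rho at this
    linarith

lemma sInf_le_aux {A B : Type*} (S : Set A) (T : Set B) (f : A → ℝ) (g : B → ℝ)
    (hS : S.Nonempty) (hg : ∀ y ∈ T, 0 ≤ g y)
    (h : ∀ x ∈ S, ∃ y ∈ T, g y ≤ f x) : sInf (g '' T) ≤ sInf (f '' S) := by
  refine le_csInf (hS.image f) ?_
  rintro _ ⟨x, hx, rfl⟩
  obtain ⟨y, hy, hyx⟩ := h x hx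
  refine (csInf_le ⟨0, ?_⟩ (Set.mem_image_of_mem g hy)).trans hyx
  rintro _ ⟨z, hz, rfl⟩
  exact hg z hz

lemma sInf_eq_aux {A B : Type*} (S : Set A) (T : Set B) (f : A → ℝ) (g : B → ℝ)
    (hf : ∀ y ∈ S, 0 ≤ f y) (hg : ∀ y ∈ T, 0 ≤ g y)
    (h : ∀ x ∈ S, ∃ y ∈ T, g y ≤ f x) (h' : ∀ y ∈ T, ∃ x ∈ S, f x ≤ g y) :
    sInf (f '' S) = sInf (g '' T) := by
  rcases S.eq_empty_or_nonempty with hS | hS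
  · have hT : T = ∅ := by
      refine Set.eq_empty_iff_forall_notMem.2 fun y hy => ?_
      obtain ⟨x, hx, _⟩ := h' y hy
      simp [hS] at hx
    simp [hS, hT]
  · have hT : T.Nonempty := by
      obtain ⟨x, hx⟩ := hS
      obtain ⟨y, hy, _⟩ := h x hx
      exact ⟨y, hy⟩
    exact le_antisymm (sInf_le_aux T S g f hT hf h') (sInf_le_aux S T f g hS hg h)

lemma split_sum_aux {J : Type*} [Fintype J] [DecidableEq J] (j₀ : J) (k : ℕ) (hk : 0 < k)
    (P : J → Prop) [DecidablePred P] (P' : ({j : J // j ≠ j₀} ⊕ Fin k) → Prop) [DecidablePred P']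
    (hPold : ∀ j : {j : J // j ≠ j₀}, P' (Sum.inl j) ↔ P j.1)
    (hPnew : ∀ r : Fin k, P' (Sum.inr r) ↔ P j₀)
    (lam m x : J → ℝ) (lam' m' x' : ({j : J // j ≠ j₀} ⊕ Fin k) → ℝ)
    (hlam'old : ∀ j : {j : J // j ≠ j₀}, lam' (Sum.inl j) = lam j.1)
    (hlam'new : ∀ r : Fin k, lam' (Sum.inr r) = lam j₀ / k)
    (hmold : ∀ j : {j : J // j ≠ j₀}, m' (Sum.inl j) = m j.1)
    (hmnew : ∀ r : Fin k, m' (Sum.inr r) = m j₀)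
    (hxold : ∀ j : {j : J // j ≠ j₀}, x' (Sum.inl j) = x j.1)
    (hxnew : ∑ r : Fin k, x' (Sum.inr r) = k * x j₀) :
    ∑ l ∈ univ.filter (fun l => P' l), x' l * lam' l / m' l =
      ∑ l ∈ univ.filter (fun l => P l), x l * lam l / m l := by
  have hk0 : (k : ℝ) ≠ 0 := by positivity
  rw [Finset.sum_filter, Finset.sum_filter, Fintype.sum_sum_type,
    Fintype.sum_eq_add_sum_subtype_ne _ j₀, add_comm]
  congr 1
  · simp only [hPnew, hlam'new, hmnew]
    split_ifs
    · simp only [mul_div_assoc]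
      rw [← Finset.sum_mul, hxnew]
      field_simp
    · simp
  · simp only [hPold, hlam'old, hmold, hxold]

/-- **Splitting invariance for task fairness.** Replacing a task type `j₀` by
`k` copies, each with the same neighborhood and service rates and arrival rate
`λ_{j₀}/k`, leaves the optimal value `η_t*` of Program P_A unchanged. -/
theorem splitting_invariance_task_fairness
    {I J : Type*} [Fintype I] [Fintype J] [Nonempty I] [Nonempty J] [DecidableEq J]
    (E : I → J → Prop) [∀ i j, Decidable (E i j)]
    (lam : J → ℝ) (mu : I → J → ℝ)
    (hlam : ∀ j, 0 < lam j) (hmu : ∀ i j, E i j → 0 < mu i j)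
    (hEj : ∀ j, ∃ i, E i j) (hEi : ∀ i, ∃ j, E i j)
    (j₀ : J) (k : ℕ) (hk : 0 < k)
    (E' : I → ({j : J // j ≠ j₀} ⊕ Fin k) → Prop) [∀ i j, Decidable (E' i j)]
    (lam' : ({j : J // j ≠ j₀} ⊕ Fin k) → ℝ)
    (mu' : I → ({j : J // j ≠ j₀} ⊕ Fin k) → ℝ)
    (hE'old : ∀ i (j : {j : J // j ≠ j₀}), E' i (Sum.inl j) ↔ E i j.1)
    (hE'new : ∀ i (r : Fin k), E' i (Sum.inr r) ↔ E i j₀)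
    (hlam'old : ∀ j : {j : J // j ≠ j₀}, lam' (Sum.inl j) = lam j.1)
    (hlam'new : ∀ r : Fin k, lam' (Sum.inr r) = lam j₀ / k)
    (hmu'old : ∀ i (j : {j : J // j ≠ j₀}), mu' i (Sum.inl j) = mu i j.1)
    (hmu'new : ∀ i (r : Fin k), mu' i (Sum.inr r) = mu i j₀) :
    etaT E' lam' mu' = etaT E lam mu := by
  have hk0 : (0 : ℝ) < k := by exact_mod_cast hk
  have : Nonempty (Fin k) := ⟨⟨0, hk⟩⟩
  have hlam' : ∀ j, 0 < lam' j := by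
    rintro (j | r)
    · rw [hlam'old]; exact hlam _
    · rw [hlam'new]; exact div_pos (hlam _) hk0
  have hmu' : ∀ i j, E' i j → 0 < mu' i j := by
    rintro i (j | r) h
    · rw [hmu'old]; exact hmu _ _ ((hE'old _ _).1 h)
    · rw [hmu'new]; exact hmu _ _ ((hE'new _ _).1 h)
  have key1 : ∀ (x : I → J → ℝ) (x' : I → ({j : J // j ≠ j₀} ⊕ Fin k) → ℝ),
      (∀ i j, x' i (Sum.inl j) = x i j.1) → (∀ i, ∑ r, x' i (Sum.inr r) = k * x i j₀) →
      ∀ i, ∑ l ∈ univ.filter (fun l => E' i l), x' i l * lam' l / mu' i l =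
        ∑ l ∈ univ.filter (fun l => E i l), x i l * lam l / mu i l := by
    intro x x' h1 h2 i
    exact split_sum_aux j₀ k hk (E i) (E' i) (hE'old i) (hE'new i) lam (mu i) (x i)
      lam' (mu' i) (x' i) hlam'old hlam'new (hmu'old i) (hmu'new i) (h1 i) (h2 i)
  have key2 : ∀ (x : I → J → ℝ) (x' : I → ({j : J // j ≠ j₀} ⊕ Fin k) → ℝ),
      (∀ i j, x' i (Sum.inl j) = x i j.1) → (∀ i, ∑ r, x' i (Sum.inr r) = k * x i j₀) →
      ∀ i, ∑ l ∈ univ.filter (fun l => E' i l), x' i l * lam' l / (mu' i l) ^ 2 =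
        ∑ l ∈ univ.filter (fun l => E i l), x i l * lam l / (mu i l) ^ 2 := by
    intro x x' h1 h2 i
    exact split_sum_aux j₀ k hk (E i) (E' i) (hE'old i) (hE'new i) lam (fun j => mu i j ^ 2) (x i)
      lam' (fun j => mu' i j ^ 2) (x' i) hlam'old hlam'new
      (fun j => by simp only [hmu'old]) (fun j => by simp only [hmu'new]) (h1 i) (h2 i)
  have keyw : ∀ (x : I → J → ℝ) (x' : I → ({j : J // j ≠ j₀} ⊕ Fin k) → ℝ),
      (∀ i j, x' i (Sum.inl j) = x i j.1) → (∀ i, ∑ r, x' i (Sum.inr r) = k * x i j₀) →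
      ∀ j, wbar E' lam' mu' x' (Sum.inl j) = wbar E lam mu x j.1 := by
    intro x x' h1 h2 j
    unfold wbar
    simp only [key1 x x' h1 h2, key2 x x' h1 h2, hE'old, h1, hmu'old]
  unfold etaT
  apply sInf_eq_aux
  · intro x hx
    exact Real.iSup_nonneg fun j => wbar_nonneg_aux E' lam' mu' hlam' hmu' x hx j
  · intro x hx
    exact Real.iSup_nonneg fun j => wbar_nonneg_aux E lam mu hlam hmu x hx j
  · intro x' hx'
    obtain ⟨⟨f1, f2, f3, f4⟩, f5⟩ := hx'
    let x : I → J → ℝ := fun i j =>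
      if h : j ≠ j₀ then x' i (Sum.inl ⟨j, h⟩) else (∑ r, x' i (Sum.inr r)) / k
    have h1 : ∀ i (j : {j : J // j ≠ j₀}), x' i (Sum.inl j) = x i j.1 := by
      intro i j
      simp [x, j.2]
    have hx0 : ∀ i, x i j₀ = (∑ r, x' i (Sum.inr r)) / k := by
      intro i
      simp [x]
    have h2 : ∀ i, ∑ r, x' i (Sum.inr r) = k * x i j₀ := by
      intro i
      rw [hx0]
      field_simp
    have hrho : ∀ i, rho E lam mu x i = rho E' lam' mu' x' i :=
      fun i => (key1 x x' h1 h2 i).symm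
    refine ⟨x, ⟨⟨?_, ?_, ?_, ?_⟩, ?_⟩, ?_⟩
    · intro i j hE
      by_cases h : j = j₀
      · subst h
        rw [hx0]
        simp [fun r => f1 i (Sum.inr r) (fun hh => hE ((hE'new i r).1 hh))]
      · rw [← h1 i ⟨j, h⟩]
        exact f1 _ _ (fun hh => hE ((hE'old i ⟨j, h⟩).1 hh))
    · intro i j
      by_cases h : j = j₀
      · subst h
        rw [hx0]
        refine ⟨div_nonneg (Finset.sum_nonneg fun r _ => (f2 i _).1) hk0.le, ?_⟩
        rw [div_le_one hk0]
        calc ∑ r, x' i (Sum.inr r) ≤ ∑ r : Fin k, (1 : ℝ) :=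
              Finset.sum_le_sum fun r _ => (f2 i _).2
          _ = k := by simp
      · rw [← h1 i ⟨j, h⟩]
        exact f2 _ _
    · intro j
      by_cases h : j = j₀
      · subst h
        simp only [hx0]
        rw [← Finset.sum_div, Finset.sum_comm, div_eq_one_iff_eq hk0.ne']
        have : ∀ r : Fin k, ∑ i ∈ univ.filter (fun i => E i j), x' i (Sum.inr r) = 1 := by
          intro r
          have := f3 (Sum.inr r)
          simpa only [hE'new] using this
        simp [this]
      · have := f3 (Sum.inl ⟨j, h⟩)
        simpa only [hE'old, h1] using this
    · intro i
      rw [hrho]; exact f4 i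
    · intro i
      rw [hrho]; exact f5 i
    · refine ciSup_le fun j => ?_
      have hb : ∀ j', wbar E' lam' mu' x' j' ≤ ⨆ j, wbar E' lam' mu' x' j :=
        fun j' => le_ciSup (Set.finite_range _).bddAbove j'
      by_cases h : j = j₀
      · have hs : ∑ r : Fin k, wbar E' lam' mu' x' (Sum.inr r) = k * wbar E lam mu x j₀ := by
          unfold wbar
          simp only [key1 x x' h1 h2, key2 x x' h1 h2, hE'new, hmu'new]
          rw [Finset.sum_comm, Finset.mul_sum]
          refine Finset.sum_congr rfl fun i _ => ?_
          rw [← Finset.sum_mul, ← Finset.sum_mul, h2]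
          ring
        have hle : ∑ r : Fin k, wbar E' lam' mu' x' (Sum.inr r) ≤
            ∑ r : Fin k, ⨆ j, wbar E' lam' mu' x' j := Finset.sum_le_sum fun r _ => hb _
        rw [hs, Finset.sum_const, Finset.card_univ, Fintype.card_fin, nsmul_eq_mul] at hle
        rw [h]
        exact le_of_mul_le_mul_left hle hk0
      · rw [← keyw x x' h1 h2 ⟨j, h⟩]
        exact hb _
  · intro x hx
    obtain ⟨⟨f1, f2, f3, f4⟩, f5⟩ := hx
    let x' : I → ({j : J // j ≠ j₀} ⊕ Fin k) → ℝ := fun i j =>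
      Sum.elim (fun j : {j : J // j ≠ j₀} => x i j.1) (fun _ => x i j₀) j
    have h1 : ∀ i (j : {j : J // j ≠ j₀}), x' i (Sum.inl j) = x i j.1 := fun i j => rfl
    have h0 : ∀ i (r : Fin k), x' i (Sum.inr r) = x i j₀ := fun i j => rfl
    have h2 : ∀ i, ∑ r, x' i (Sum.inr r) = k * x i j₀ := by
      intro i
      simp [h0]
    have hrho : ∀ i, rho E' lam' mu' x' i = rho E lam mu x i :=
      fun i => key1 x x' h1 h2 i
    refine ⟨x', ⟨⟨?_, ?_, ?_, ?_⟩, ?_⟩, ?_⟩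
    · rintro i (j | r) hE
      · exact f1 _ _ (fun hh => hE ((hE'old i j).2 hh))
      · exact f1 _ _ (fun hh => hE ((hE'new i r).2 hh))
    · rintro i (j | r)
      · exact f2 _ _
      · exact f2 _ _
    · rintro (j | r)
      · simpa only [hE'old, h1] using f3 j.1
      · simpa only [hE'new, h0] using f3 j₀
    · intro i
      rw [hrho]; exact f4 i
    · intro i
      rw [hrho]; exact f5 i
    · refine ciSup_le fun j => ?_
      have hb : ∀ j', wbar E lam mu x j' ≤ ⨆ j, wbar E lam mu x j :=
        fun j' => le_ciSup (Set.finite_range _).bddAbove j'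
      rcases j with j | r
      · rw [keyw x x' h1 h2 j]
        exact hb _
      · have : wbar E' lam' mu' x' (Sum.inr r) = wbar E lam mu x j₀ := by
          unfold wbar
          simp only [key1 x x' h1 h2, key2 x x' h1 h2, hE'new, hmu'new, h0]
        rw [this]
        exact hb _
end

section
/- Lower bound on waiting times by the optimal maximum workload (uniform case): Assume the uniform case, i.e. there are μ_i > 0 with μ_{ij} = μ_i for every j ∼ i, and λ_j = λ > 0 for every j ∈ J, and assume η_s* < 1. Then for every strictly feasible x, max_{j ∈ J} ((∑_{i ∼ j} x_{ij} / (1 − ρ_i(x))) − 1) ≥ 1/(1 − η_s*) − 1; consequently 1/(1 − η_s*) − 1 ≤ η̄_t*, where η̄_t* is the optimal value of Program P̄_A. -/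
open Finset

def PP {I J : Type*} [Fintype I] (E : I → J → Prop) : Set (I → J → ℝ) :=
  {x | (∀ i j, ¬ E i j → x i j = 0) ∧ (∀ i j, 0 ≤ x i j) ∧ (∀ j, ∑ i, x i j = 1)}

lemma PP_le_one {I J : Type*} [Fintype I] {E : I → J → Prop} {x : I → J → ℝ}
    (hx : x ∈ PP E) (i : I) (j : J) : x i j ≤ 1 := by
  rw [← hx.2.2 j]
  exact Finset.single_le_sum (f := fun i => x i j) (fun i _ => hx.2.1 i j) (Finset.mem_univ i)

lemma PP_compact {I J : Type*} [Fintype I] [Fintype J] (E : I → J → Prop) :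
    IsCompact (PP E) := by
  have hsub : PP E ⊆ Set.Icc (0 : I → J → ℝ) 1 := by
    intro x hx
    exact ⟨fun i j => hx.2.1 i j, fun i j => PP_le_one hx i j⟩
  refine IsCompact.of_isClosed_subset isCompact_Icc ?_ hsub
  have : PP E = (⋂ i, ⋂ j, ⋂ (_ : ¬ E i j), {x : I → J → ℝ | x i j = 0}) ∩
      ((⋂ i, ⋂ j, {x : I → J → ℝ | 0 ≤ x i j}) ∩ ⋂ j, {x : I → J → ℝ | ∑ i, x i j = 1}) := by
    ext x; simp [PP]
  rw [this]
  refine IsClosed.inter ?_ (IsClosed.inter ?_ ?_)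
  · refine isClosed_iInter fun i => isClosed_iInter fun j => isClosed_iInter fun _ => ?_
    exact isClosed_eq (by fun_prop) (by fun_prop)
  · refine isClosed_iInter fun i => isClosed_iInter fun j => ?_
    exact isClosed_le (by fun_prop) (by fun_prop)
  · refine isClosed_iInter fun j => ?_
    exact isClosed_eq (by fun_prop) (by fun_prop)

lemma exists_balanced {I J : Type*} [Fintype I] [Fintype J] (E : I → J → Prop)
    (m : I → ℝ) (hm : ∀ i, 0 < m i) (hne : (PP E).Nonempty) :
    ∃ z ∈ PP E, ∀ j k, E k j →
      ∑ i, z i j * ((∑ l, z i l) / m i) ≤ (∑ l, z k l) / m k := by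
  classical
  obtain ⟨z, hz, hmin⟩ := (PP_compact E).exists_isMinOn hne
    (f := fun x : I → J → ℝ => ∑ i, (∑ l, x i l) ^ 2 / m i) (by fun_prop)
  refine ⟨z, hz, ?_⟩
  have first : ∀ y ∈ PP E, 0 ≤ ∑ i, (∑ l, z i l) * (∑ l, (y i l - z i l)) / m i := by
    intro y hy
    by_contra! hB
    set B := ∑ i, (∑ l, z i l) * (∑ l, (y i l - z i l)) / m i with hBdef
    set C := ∑ i, (∑ l, (y i l - z i l)) ^ 2 / m i with hCdef
    have hC : 0 ≤ C := Finset.sum_nonneg fun i _ => div_nonneg (sq_nonneg _) (hm i).le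
    have key : ∀ t : ℝ, 0 < t → t ≤ 1 → 0 ≤ 2 * t * B + t ^ 2 * C := by
      intro t ht ht1
      have hmem : (fun i j => z i j + t * (y i j - z i j)) ∈ PP E := by
        refine ⟨fun i j h => ?_, fun i j => ?_, fun j => ?_⟩
        · simp [hz.1 i j h, hy.1 i j h]
        · have h1 := hz.2.1 i j
          have h2 := hy.2.1 i j
          nlinarith
        · rw [Finset.sum_add_distrib, ← Finset.mul_sum, Finset.sum_sub_distrib,
            hz.2.2 j, hy.2.2 j]
          ring
      have := hmin hmem
      simp only [Set.mem_setOf_eq] at this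
      have e : ∑ i, (∑ l, (z i l + t * (y i l - z i l))) ^ 2 / m i
          = ∑ i, (∑ l, z i l) ^ 2 / m i + (2 * t * B + t ^ 2 * C) := by
        rw [hBdef, hCdef, Finset.mul_sum, Finset.mul_sum, ← Finset.sum_add_distrib,
          ← Finset.sum_add_distrib]
        refine Finset.sum_congr rfl fun i _ => ?_
        rw [Finset.sum_add_distrib, ← Finset.mul_sum]
        ring
      rw [e] at this
      linarith
    have ht : 0 < min 1 (-B / (C + 1)) := lt_min one_pos (div_pos (by linarith) (by linarith))
    have h := key _ ht (min_le_left _ _)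
    have h2 : min 1 (-B / (C + 1)) * (C + 1) ≤ -B := by
      rw [← le_div_iff₀ (by linarith)]
      exact min_le_right _ _
    generalize min 1 (-B / (C + 1)) = t at *
    nlinarith
  intro j k hkj
  have hy : (fun i l => if l = j then (if i = k then 1 else 0) else z i l) ∈ PP E := by
    refine ⟨fun i l h => ?_, fun i l => ?_, fun l => ?_⟩
    · by_cases hl : l = j
      · subst hl
        have : i ≠ k := by rintro rfl; exact h hkj
        simp [this]
      · simp [hl, hz.1 i l h]
    · have := hz.2.1 i l
      dsimp only
      split_ifs <;> first | exact this | norm_num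
    · by_cases hl : l = j
      · simp [hl]
      · simp [hl, hz.2.2 l]
  have h := first _ hy
  have e : ∀ i, ∑ l, ((if l = j then (if i = k then (1:ℝ) else 0) else z i l) - z i l)
      = (if i = k then 1 else 0) - z i j := by
    intro i
    rw [Finset.sum_eq_single j]
    · simp
    · intro l _ hl; simp [hl]
    · simp
  simp only [e] at h
  have e2 : ∑ i, (∑ l, z i l) * ((if i = k then (1:ℝ) else 0) - z i j) / m i
      = (∑ l, z k l) / m k - ∑ i, z i j * ((∑ l, z i l) / m i) := by
    have : ∀ i, (∑ l, z i l) * ((if i = k then (1:ℝ) else 0) - z i j) / m i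
      = (if i = k then (∑ l, z i l) / m i else 0) - z i j * ((∑ l, z i l) / m i) := by
      intro i; split_ifs <;> ring
    simp only [this, Finset.sum_sub_distrib]
    simp
  rw [e2] at h
  linarith

/-- tight set -/
lemma exists_tight {I J : Type*} [Fintype I] [Fintype J] [Nonempty I] [Nonempty J]
    (E : I → J → Prop)
    (m : I → ℝ) (hm : ∀ i, 0 < m i) (hne : (PP E).Nonempty) :
    ∃ z ∈ PP E, ∃ (M : ℝ) (S : Finset J) (T : Finset I), 0 < M ∧ S.Nonempty ∧
      (∀ i, (∑ l, z i l) / m i ≤ M) ∧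
      (∀ j ∈ S, ∀ i, E i j → i ∈ T) ∧ (S.card : ℝ) = M * ∑ i ∈ T, m i := by
  classical
  obtain ⟨z, hz, hb⟩ := exists_balanced E m hm hne
  obtain ⟨i0, hi0⟩ := Finite.exists_max (fun i => (∑ l, z i l) / m i)
  set r : I → ℝ := fun i => (∑ l, z i l) / m i with hr
  have hr' : ∀ i, ∑ l, z i l = r i * m i := fun i => by
    simp only [hr]; field_simp [(hm i).ne']
  have hMpos : 0 < r i0 := by
    by_contra! hle
    obtain ⟨j⟩ := ‹Nonempty J›
    have h0 : ∀ i, z i j = 0 := by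
      intro i
      have h1 : z i j ≤ ∑ l, z i l :=
        Finset.single_le_sum (f := fun l => z i l) (fun l _ => hz.2.1 i l) (Finset.mem_univ j)
      have h2 : r i ≤ 0 := (hi0 i).trans hle
      have h3 := hr' i
      have h4 := hz.2.1 i j
      nlinarith [hm i]
    have := hz.2.2 j
    simp [h0] at this
  have hsupp : ∀ i j, r i = r i0 → 0 < z i j → ∀ k, E k j → r k = r i0 := by
    intro i j hi hij k hk
    set A := ∑ i, z i j * r i with hA
    have hAle : ∀ k, E k j → A ≤ r k := fun k hk => hb j k hk
    have hnn : ∀ i ∈ Finset.univ, 0 ≤ z i j * (r i - A) := by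
      intro i _
      by_cases h : E i j
      · exact mul_nonneg (hz.2.1 i j) (sub_nonneg.2 (hAle i h))
      · simp [hz.1 i j h]
    have hs : ∑ i, z i j * (r i - A) = 0 := by
      simp only [mul_sub, Finset.sum_sub_distrib, ← Finset.sum_mul, hz.2.2 j]
      rw [← hA]; ring
    have := (Finset.sum_eq_zero_iff_of_nonneg hnn).1 hs i (Finset.mem_univ i)
    have hiA : r i = A := by
      rcases mul_eq_zero.1 this with h | h <;> linarith
    have := hAle k hk
    have := hi0 k
    apply le_antisymm
    · exact this
    · linarith
  let S : Finset J := Finset.univ.filter (fun j => ∀ k, E k j → r k = r i0)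
  let T : Finset I := Finset.univ.filter (fun i => r i = r i0)
  have hST : ∀ j ∈ S, ∀ i, E i j → i ∈ T := by
    intro j hj i hij
    simp only [S, T, Finset.mem_filter, Finset.mem_univ, true_and] at *
    exact hj i hij
  have hTS : ∀ i ∈ T, ∀ j, j ∉ S → z i j = 0 := by
    intro i hi j hj
    by_contra hne
    apply hj
    simp only [S, T, Finset.mem_filter, Finset.mem_univ, true_and] at *
    exact hsupp i j hi (lt_of_le_of_ne (hz.2.1 i j) (Ne.symm hne))
  refine ⟨z, hz, r i0, S, T, hMpos, ?_, hi0, hST, ?_⟩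
  · have : 0 < ∑ l, z i0 l := by rw [hr']; exact mul_pos hMpos (hm i0)
    obtain ⟨j, _, hj⟩ := Finset.exists_lt_of_sum_lt (s := Finset.univ) (f := fun _ => (0:ℝ))
      (g := fun l => z i0 l) (by simpa using this)
    exact ⟨j, by
      simp only [S, Finset.mem_filter, Finset.mem_univ, true_and]
      exact hsupp i0 j rfl hj⟩
  · have h1 : ∀ j ∈ S, ∑ i ∈ T, z i j = 1 := by
      intro j hj
      rw [← hz.2.2 j]
      refine Finset.sum_subset (Finset.subset_univ _) fun i _ hi => hz.1 i j fun h => hi (hST j hj i h)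
    have h2 : ∀ i ∈ T, ∑ j ∈ S, z i j = r i0 * m i := by
      intro i hi
      have : r i = r i0 := by simpa [T] using hi
      rw [← this, ← hr']
      exact Finset.sum_subset (Finset.subset_univ _) fun j _ hj => hTS i hi j hj
    calc (S.card : ℝ) = ∑ j ∈ S, ∑ i ∈ T, z i j := by
          rw [Finset.sum_congr rfl h1]; simp
      _ = ∑ i ∈ T, ∑ j ∈ S, z i j := Finset.sum_comm
      _ = _ := by rw [Finset.sum_congr rfl h2, Finset.mul_sum]

lemma key_ineq {I J : Type*} [Fintype I] [Fintype J]
    (E : I → J → Prop) (m : I → ℝ) (hm : ∀ i, 0 < m i)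
    (M : ℝ) (hM0 : 0 < M) (S : Finset J) (T : Finset I)
    (hST : ∀ j ∈ S, ∀ i, E i j → i ∈ T) (hcard : (S.card : ℝ) = M * ∑ i ∈ T, m i)
    (x : I → J → ℝ) (hx : x ∈ PP E) (r : I → ℝ) (hr : ∀ i, r i * m i = ∑ l, x i l) :
    S.card * M ≤ ∑ j ∈ S, ∑ i, x i j * r i := by
  have h1 : ∀ j ∈ S, ∑ i, x i j * r i = ∑ i ∈ T, x i j * r i := by
    intro j hj
    symm
    refine Finset.sum_subset (Finset.subset_univ _) fun i _ hi => ?_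
    rw [hx.1 i j fun h => hi (hST j hj i h), zero_mul]
  have h1' : ∀ j ∈ S, ∑ i ∈ T, x i j = 1 := by
    intro j hj
    rw [← hx.2.2 j]
    exact Finset.sum_subset (Finset.subset_univ _) fun i _ hi => hx.1 i j fun h => hi (hST j hj i h)
  have hy : ∑ i ∈ T, ∑ j ∈ S, x i j = S.card := by
    rw [Finset.sum_comm, Finset.sum_congr rfl h1']; simp
  rw [Finset.sum_congr rfl h1, Finset.sum_comm]
  have h2 : ∀ i ∈ T, 2 * M * (∑ j ∈ S, x i j) - M ^ 2 * m i ≤ ∑ j ∈ S, x i j * r i := by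
    intro i _
    rw [← Finset.sum_mul]
    have hy0 : 0 ≤ ∑ j ∈ S, x i j := Finset.sum_nonneg fun j _ => hx.2.1 i j
    have hle : ∑ j ∈ S, x i j ≤ r i * m i := by
      rw [hr]
      exact Finset.sum_le_sum_of_subset_of_nonneg (Finset.subset_univ _) fun j _ _ => hx.2.1 i j
    generalize ∑ j ∈ S, x i j = y at *
    have hmi := hm i
    have h3 : 0 ≤ y * (r i * m i - y) := mul_nonneg hy0 (by linarith)
    have : 0 ≤ m i * (y * r i - (2 * M * y - M ^ 2 * m i)) := by
      nlinarith [sq_nonneg (y - M * m i)]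
    have := nonneg_of_mul_nonneg_right this hmi
    linarith
  have h3 := Finset.sum_le_sum h2
  rw [Finset.sum_sub_distrib, ← Finset.mul_sum, ← Finset.mul_sum, hy] at h3
  have : M ^ 2 * ∑ i ∈ T, m i = M * S.card := by rw [hcard]; ring
  linarith

lemma main_bound
    {I J : Type*} [Fintype I] [Fintype J] [Nonempty I] [Nonempty J]
    (E : I → J → Prop) [∀ i j, Decidable (E i j)]
    (lam : J → ℝ) (mu : I → J → ℝ)
    (lam0 : ℝ) (hlam0 : 0 < lam0) (hlamu : ∀ j, lam j = lam0)
    (mui : I → ℝ) (hmui : ∀ i, 0 < mui i)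
    (hmuu : ∀ i j, E i j → mu i j = mui i)
    (x : I → J → ℝ) (hxs : StrictFeasible E lam mu x) :
      1 / (1 - etaS E lam mu) - 1 ≤
        (⨆ j, (∑ i ∈ univ.filter (fun i => E i j), x i j / (1 - rho E lam mu x i)) - 1) := by
  have hfilt : ∀ (x : I → J → ℝ), (∀ i j, ¬ E i j → x i j = 0) → ∀ (w : I → ℝ) j,
      ∑ i ∈ univ.filter (fun i => E i j), x i j * w i = ∑ i, x i j * w i := by
    intro x hx w j
    refine Finset.sum_subset (Finset.subset_univ _) fun i _ hi => ?_
    rw [hx i j (by simpa using hi), zero_mul]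
  have hfilt1 : ∀ (x : I → J → ℝ), (∀ i j, ¬ E i j → x i j = 0) → ∀ j,
      ∑ i ∈ univ.filter (fun i => E i j), x i j = ∑ i, x i j := by
    intro x hx j
    simpa using hfilt x hx (fun _ => 1) j
  set m : I → ℝ := fun i => mui i / lam0 with hmdef
  have hm : ∀ i, 0 < m i := fun i => div_pos (hmui i) hlam0
  have hrho : ∀ (x : I → J → ℝ), (∀ i j, ¬ E i j → x i j = 0) → ∀ i,
      rho E lam mu x i = (∑ l, x i l) / m i := by
    intro x hx i
    unfold rho
    rw [Finset.sum_div]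
    rw [← Finset.sum_subset (Finset.subset_univ (univ.filter (fun l => E i l)))]
    · refine Finset.sum_congr rfl fun l hl => ?_
      have hl : E i l := by simpa using hl
      rw [hlamu, hmuu i l hl, hmdef]
      field_simp
    · intro l _ hl
      rw [hx i l (by simpa using hl), zero_div]
  obtain ⟨⟨hx0, hx1, hx2, -⟩, hx4⟩ := hxs
  have hxP : x ∈ PP E := ⟨hx0, fun i j => (hx1 i j).1, fun j => by rw [← hfilt1 x hx0, hx2]⟩
  obtain ⟨z, hz, M, S, T, hM0, hSne, hzM, hST, hcard⟩ := exists_tight E m hm ⟨x, hxP⟩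
  set r := rho E lam mu x with hrdef
  have hr : ∀ i, r i * m i = ∑ l, x i l := fun i => by
    rw [hrdef, hrho x hx0]; field_simp [(hm i).ne']
  have key := key_ineq E m hm M hM0 S T hST hcard x hxP r hr
  have hSc : (0:ℝ) < S.card := by exact_mod_cast hSne.card_pos
  obtain ⟨j, hjS, hj⟩ : ∃ j ∈ S, M ≤ ∑ i, x i j * r i := by
    apply Finset.exists_le_of_sum_le hSne
    simpa using key
  have hM1 : M < 1 := by
    obtain ⟨i0, hi0⟩ := Finite.exists_max r
    have : ∑ i, x i j * r i ≤ ∑ i, x i j * r i0 :=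
      Finset.sum_le_sum fun i _ => mul_le_mul_of_nonneg_left (hi0 i) (hx1 i j).1
    rw [← Finset.sum_mul, hxP.2.2 j] at this
    linarith [hx4 i0]
  have heta : etaS E lam mu ≤ M := by
    have hzF : Feasible E lam mu z := by
      refine ⟨hz.1, fun i j => ⟨hz.2.1 i j, PP_le_one hz i j⟩, fun j => ?_, fun i => ?_⟩
      · rw [hfilt1 z hz.1, hz.2.2]
      · rw [hrho z hz.1]; linarith [hzM i]
    have hle : (⨆ i, rho E lam mu z i) ≤ M := ciSup_le fun i => by rw [hrho z hz.1]; exact hzM i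
    refine le_trans (csInf_le ?_ ⟨z, hzF, rfl⟩) hle
    refine ⟨0, ?_⟩
    rintro _ ⟨y, hy, rfl⟩
    refine Real.iSup_nonneg fun i => ?_
    rw [hrho y hy.1]
    exact div_nonneg (Finset.sum_nonneg fun l _ => (hy.2.1 i l).1) (hm i).le
  have hW : 1 / (1 - M) ≤ ∑ i ∈ univ.filter (fun i => E i j), x i j / (1 - r i) := by
    have e : ∑ i ∈ univ.filter (fun i => E i j), x i j / (1 - r i)
        = ∑ i, x i j * (1 - r i)⁻¹ := by
      rw [← hfilt x hx0]; rfl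
    rw [e]
    set a := 1 / (1 - M) with ha
    have hM1' : 0 < 1 - M := by linarith
    have ha0 : a * (1 - M) = 1 := by rw [ha]; field_simp
    have hpt : ∀ i ∈ Finset.univ, x i j * a + a ^ 2 * (x i j * r i) - a ^ 2 * M * x i j
        ≤ x i j * (1 - r i)⁻¹ := by
      intro i _
      have h1 : 0 < 1 - r i := by linarith [hx4 i]
      have : a + a ^ 2 * (r i - M) ≤ (1 - r i)⁻¹ := by
        have hb : (1 - r i)⁻¹ * (1 - r i) = 1 := inv_mul_cancel₀ h1.ne'
        have hb0 : 0 < (1 - r i)⁻¹ := inv_pos.2 h1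
        generalize (1 - r i)⁻¹ = b at *
        have hid : b - (a + a ^ 2 * (r i - M)) = b * (1 - a * (1 - r i)) ^ 2 := by
          have : r i - M = (1 - M) - (1 - r i) := by ring
          rw [this]
          linear_combination (2 * a - a ^ 2 * (1 - r i)) * hb - a * ha0
        nlinarith [mul_nonneg hb0.le (sq_nonneg (1 - a * (1 - r i)))]
      have := mul_le_mul_of_nonneg_left this (hx1 i j).1
      linarith
    have := Finset.sum_le_sum hpt
    rw [Finset.sum_sub_distrib, Finset.sum_add_distrib, ← Finset.sum_mul, ← Finset.mul_sum,
      ← Finset.mul_sum, hxP.2.2 j] at this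
    nlinarith [sq_nonneg a, mul_le_mul_of_nonneg_left hj (sq_nonneg a)]
  have h1 : 1 / (1 - etaS E lam mu) ≤ 1 / (1 - M) :=
    one_div_le_one_div_of_le (by linarith) (by linarith)
  refine le_trans ?_ (le_ciSup (f := fun j => (∑ i ∈ univ.filter (fun i => E i j),
    x i j / (1 - r i)) - 1) (Set.finite_range _).bddAbove j)
  linarith

/-- **Lower bound on waiting times by the optimal maximum workload (uniform
case).** If `η_s* < 1`, then every strictly feasible `x` has P̄_A-objective at
least `1/(1 − η_s*) − 1`; consequently `1/(1 − η_s*) − 1 ≤ η̄_t*`. -/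
theorem waiting_time_ge_of_opt_workload_uniform
    {I J : Type*} [Fintype I] [Fintype J] [Nonempty I] [Nonempty J]
    (E : I → J → Prop) [∀ i j, Decidable (E i j)]
    (lam : J → ℝ) (mu : I → J → ℝ)
    (hlam : ∀ j, 0 < lam j) (hmu : ∀ i j, E i j → 0 < mu i j)
    (hEj : ∀ j, ∃ i, E i j) (hEi : ∀ i, ∃ j, E i j)
    (lam0 : ℝ) (hlam0 : 0 < lam0) (hlamu : ∀ j, lam j = lam0)
    (mui : I → ℝ) (hmui : ∀ i, 0 < mui i)
    (hmuu : ∀ i j, E i j → mu i j = mui i)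
    (hetaS : etaS E lam mu < 1) :
    (∀ x, StrictFeasible E lam mu x →
      1 / (1 - etaS E lam mu) - 1 ≤
        (⨆ j, (∑ i ∈ univ.filter (fun i => E i j), x i j / (1 - rho E lam mu x i)) - 1)) ∧
    1 / (1 - etaS E lam mu) - 1 ≤ etaTbar E lam mu := by
  have hmain : ∀ x, StrictFeasible E lam mu x → _ := fun x hx =>
    main_bound E lam mu lam0 hlam0 hlamu mui hmui hmuu x hx
  refine ⟨hmain, ?_⟩
  by_cases hne : {x | StrictFeasible E lam mu x}.Nonempty
  · refine le_csInf (hne.image _) ?_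
    rintro _ ⟨x, hx, rfl⟩
    exact hmain x hx
  · have hF : {x | Feasible E lam mu x} = ∅ := by
      by_contra h
      have h := Set.nonempty_iff_ne_empty.2 h
      obtain ⟨_, ⟨x, hx, rfl⟩, hlt⟩ := exists_lt_of_csInf_lt (h.image _) hetaS
      exact hne ⟨x, hx, fun i => lt_of_le_of_lt
        (le_ciSup (Set.finite_range (rho E lam mu x)).bddAbove i) hlt⟩
    have h1 : etaS E lam mu = 0 := by
      unfold etaS; rw [hF]; simp
    have h2 : etaTbar E lam mu = 0 := by
      unfold etaTbar; rw [Set.not_nonempty_iff_eq_empty.1 hne]; simp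
    rw [h1, h2]; norm_num
end

section
/- Optimality transfer in the uniform case (κ = 1): Assume the uniform case, i.e. there are μ_i > 0 with μ_{ij} = μ_i for every j ∼ i, and λ_j = λ > 0 for every j ∈ J. Let x* be a feasible solution with max_{i ∈ I} ρ_i(x*) = η_s* < 1. Then max_{j ∈ J} w̄_j(x*) = η_t*, i.e. the optimal solution of Program P_B is also an optimal solution of Program P_A. -/
open Finset

/-- Simplified allocations. -/
def Alloc {I J : Type*} [Fintype I] (E : I → J → Prop) (x : I → J → ℝ) : Prop :=
  (∀ i j, ¬ E i j → x i j = 0) ∧ (∀ i j, 0 ≤ x i j) ∧ (∀ j, ∑ i, x i j = 1)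

theorem shift_exists {I J : Type*} [Fintype I] [Fintype J] [DecidableEq I] [DecidableEq J]
    (E : I → J → Prop) (x : I → J → ℝ) (hx : Alloc E x) (i k : I) (j : J) (hik : i ≠ k)
    (hEk : E k j) (ε : ℝ) (hε : 0 ≤ ε) (hεx : ε ≤ x i j) :
    ∃ y : I → J → ℝ, Alloc E y ∧ ∀ a, ∑ b, y a b =
      ∑ b, x a b + (if a = k then ε else 0) - (if a = i then ε else 0) := by
  obtain ⟨h0, h1, h2⟩ := hx
  refine ⟨fun a b => x a b + (if b = j then (if a = k then ε else 0) else 0)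
    - (if b = j then (if a = i then ε else 0) else 0), ⟨?_, ?_, ?_⟩, ?_⟩
  · intro a b hab
    have hz := h0 a b hab
    by_cases hb : b = j
    · subst hb
      have hak : a ≠ k := by rintro rfl; exact hab hEk
      by_cases hai : a = i
      · subst hai
        have : ε = 0 := by linarith
        simp [hz, this]
      · simp [hz, hak, hai]
    · simp [hz, hb]
  · intro a b
    have hz := h1 a b
    by_cases hb : b = j
    · subst hb
      by_cases hai : a = i
      · subst hai
        simp [hik]; linarith
      · by_cases hak : a = k
        · simp [hai, hak, hik.symm] at *; linarith
        · simp [hai, hak]; linarith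
    · simp [hb]; linarith
  · intro b
    rw [Finset.sum_sub_distrib, Finset.sum_add_distrib, h2]
    by_cases hb : b = j <;> simp [hb]
  · intro a
    rw [Finset.sum_sub_distrib, Finset.sum_add_distrib]
    simp

theorem bottleneck {I J : Type*} [Fintype I] [Fintype J] [Nonempty J]
    (E : I → J → Prop) (c : ℝ) (hc : 0 < c) (m : I → ℝ) (hm : ∀ i, 0 < m i) (η : ℝ)
    (xs : I → J → ℝ) (hxs : Alloc E xs) (hxη : ∀ i, (∑ b, xs i b) * c ≤ m i * η)
    (hopt : ∀ x, Alloc E x → (∀ i, (∑ b, x i b) * c ≤ m i * η) →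
      ∃ i, (∑ b, x i b) * c = m i * η) :
    ∃ (S : Finset J) (T : Finset I), S.Nonempty ∧ (∀ j ∈ S, ∀ i, E i j → i ∈ T) ∧
      (∑ i ∈ T, m i) * η = c * S.card := by
  classical
  let tight : (I → J → ℝ) → Finset I := fun x =>
    univ.filter (fun i => (∑ b, x i b) * c = m i * η)
  have hex : ∃ n : ℕ, ∃ x, Alloc E x ∧ (∀ i, (∑ b, x i b) * c ≤ m i * η) ∧
      (tight x).card = n := ⟨_, xs, hxs, hxη, rfl⟩
  obtain ⟨x, hx, hxle, hcard⟩ := Nat.find_spec hex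
  have hmin : ∀ y, Alloc E y → (∀ i, (∑ b, y i b) * c ≤ m i * η) →
      (tight x).card ≤ (tight y).card := by
    intro y hy hyle
    rw [hcard]
    exact Nat.find_min' hex ⟨y, hy, hyle, rfl⟩
  have hx' := hx
  obtain ⟨h0, h1, h2⟩ := hx'
  have hη : 0 < η := by
    obtain ⟨j⟩ := ‹Nonempty J›
    have : ∃ i ∈ (univ : Finset I), 0 < x i j := by
      by_contra hcon
      push Not at hcon
      have := Finset.sum_nonpos hcon
      rw [h2] at this
      linarith
    obtain ⟨i, -, hi⟩ := this
    have hs : x i j ≤ ∑ b, x i b := Finset.single_le_sum (f := fun b => x i b) (fun b _ => h1 i b) (mem_univ j)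
    have hpos : 0 < m i * η := lt_of_lt_of_le (mul_pos (lt_of_lt_of_le hi hs) hc) (hxle i)
    exact pos_of_mul_pos_right hpos (hm i).le
  have key : ∀ i ∈ tight x, ∀ j, 0 < x i j → ∀ k, E k j → k ∈ tight x := by
    intro i hi j hij k hk
    by_contra hkt
    have hik : i ≠ k := by rintro rfl; exact hkt hi
    have hklt : (∑ b, x k b) * c < m k * η := by
      refine lt_of_le_of_ne (hxle k) ?_
      intro h; exact hkt (by simp [tight, h])
    have hit : (∑ b, x i b) * c = m i * η := by simpa [tight] using hi
    set ε := min (x i j) ((m k * η - (∑ b, x k b) * c) / c / 2) with hεd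
    have hd : 0 < (m k * η - (∑ b, x k b) * c) / c := div_pos (by linarith) hc
    have hε : 0 < ε := lt_min hij (by linarith)
    have hε2 : ε < (m k * η - (∑ b, x k b) * c) / c :=
      lt_of_le_of_lt (min_le_right _ _) (by linarith)
    rw [lt_div_iff₀ hc] at hε2
    obtain ⟨y, hy, hys⟩ := shift_exists E x hx i k j hik hk ε hε.le (min_le_left _ _)
    have hec : 0 < ε * c := mul_pos hε hc
    have hyi : (∑ b, y i b) * c < m i * η := by
      rw [hys]; simp [hik]; nlinarith
    have hyk : (∑ b, y k b) * c < m k * η := by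
      rw [hys]; simp [hik.symm]; nlinarith
    have hyo : ∀ a, a ≠ i → a ≠ k → ∑ b, y a b = ∑ b, x a b := by
      intro a ha hb
      rw [hys]; simp [ha, hb]
    have hyle : ∀ a, (∑ b, y a b) * c ≤ m a * η := by
      intro a
      by_cases ha : a = i
      · subst ha; exact hyi.le
      by_cases hb : a = k
      · subst hb; exact hyk.le
      rw [hyo a ha hb]; exact hxle a
    have hlt : (tight y).card < (tight x).card := by
      apply Finset.card_lt_card
      rw [Finset.ssubset_iff_of_subset]
      · refine ⟨i, hi, ?_⟩
        simp [tight, hyi.ne]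
      · intro a ha
        have ha' : (∑ b, y a b) * c = m a * η := by simpa [tight] using ha
        by_cases h3 : a = i
        · subst h3; exact hi
        by_cases h4 : a = k
        · subst h4; exact absurd ha' hyk.ne
        rw [hyo a h3 h4] at ha'
        simp [tight, ha']
    exact absurd (hmin y hy hyle) (not_le.mpr hlt)
  let S : Finset J := univ.filter (fun j => ∃ i ∈ tight x, 0 < x i j)
  have hST : ∀ j ∈ S, ∀ k, E k j → k ∈ tight x := by
    intro j hj k hk
    obtain ⟨i, hi, hij⟩ := (Finset.mem_filter.mp hj).2
    exact key i hi j hij k hk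
  refine ⟨S, tight x, ?_, hST, ?_⟩
  · obtain ⟨i, hi⟩ := hopt x hx hxle
    have hpos : 0 < (∑ b, x i b) * c := hi ▸ mul_pos (hm i) hη
    have hsp : 0 < ∑ b, x i b := pos_of_mul_pos_left hpos hc.le
    have : ∃ j ∈ (univ : Finset J), 0 < x i j := by
      by_contra hcon
      push Not at hcon
      have := Finset.sum_nonpos hcon
      linarith
    obtain ⟨j, -, hj⟩ := this
    exact ⟨j, Finset.mem_filter.mpr ⟨mem_univ _, i, by simp [tight, hi], hj⟩⟩
  · have e1 : (∑ i ∈ tight x, m i) * η = ∑ i ∈ tight x, (∑ b ∈ S, x i b) * c := by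
      rw [Finset.sum_mul]
      refine Finset.sum_congr rfl fun i hi => ?_
      have hit : (∑ b, x i b) * c = m i * η := by simpa [tight] using hi
      rw [← hit]
      congr 1
      symm
      apply Finset.sum_subset (Finset.subset_univ _)
      intro b _ hb
      by_contra hne
      exact hb (Finset.mem_filter.mpr ⟨mem_univ _, i, hi, lt_of_le_of_ne (h1 i b) (Ne.symm hne)⟩)
    rw [e1, ← Finset.sum_mul, Finset.sum_comm]
    have e2 : ∀ b ∈ S, ∑ i ∈ tight x, x i b = 1 := by
      intro b hb
      rw [← h2 b]
      apply Finset.sum_subset (Finset.subset_univ _)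
      intro i _ hi
      apply h0
      intro hE
      exact hi (hST b hb i hE)
    rw [Finset.sum_congr rfl e2]
    simp [mul_comm]

theorem tangent (t η : ℝ) (ht : t < 1) (hη : η < 1) :
    η * (η / (1 - η)) + (1 / (1 - η) ^ 2 - 1) * (t - η) ≤ t * (t / (1 - t)) := by
  have h1 : 0 < 1 - t := by linarith
  have h2 : 0 < 1 - η := by linarith
  have : t * (t / (1 - t)) - (η * (η / (1 - η)) + (1 / (1 - η) ^ 2 - 1) * (t - η))
      = (t - η) ^ 2 / ((1 - t) * (1 - η) ^ 2) := by
    field_simp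
    ring
  have h3 : 0 ≤ (t - η) ^ 2 / ((1 - t) * (1 - η) ^ 2) := by positivity
  linarith

theorem frac_mono {a b : ℝ} (hab : a ≤ b) (hb : b < 1) : a / (1 - a) ≤ b / (1 - b) := by
  rw [div_le_div_iff₀ (by linarith) (by linarith)]
  nlinarith

theorem lower {I J : Type*} [Fintype I] [Fintype J]
    (E : I → J → Prop) (c : ℝ) (hc : 0 < c) (m : I → ℝ) (hm : ∀ i, 0 < m i) (η : ℝ)
    (hη : η < 1) (S : Finset J) (T : Finset I) (hS : S.Nonempty)
    (hST : ∀ j ∈ S, ∀ i, E i j → i ∈ T) (heq : (∑ i ∈ T, m i) * η = c * S.card)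
    (x : I → J → ℝ) (hx : Alloc E x) (r : I → ℝ) (hr : ∀ i, (∑ b, x i b) * c = m i * r i)
    (hr1 : ∀ i, r i < 1) :
    ∃ j, η / (1 - η) ≤ ∑ i, x i j * (r i / (1 - r i)) := by
  obtain ⟨h0, h1, h2⟩ := hx
  by_contra hcon
  push Not at hcon
  have hlt : ∑ j ∈ S, ∑ i, x i j * (r i / (1 - r i)) < ∑ j ∈ S, η / (1 - η) :=
    Finset.sum_lt_sum_of_nonempty hS fun j _ => hcon j
  have eT : ∀ f : I → ℝ, ∀ j ∈ S, ∑ i, x i j * f i = ∑ i ∈ T, x i j * f i := by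
    intro f j hj
    symm
    apply Finset.sum_subset (Finset.subset_univ _)
    intro i _ hi
    rw [h0 i j (fun hE => hi (hST j hj i hE)), zero_mul]
  rw [Finset.sum_congr rfl (eT _), Finset.sum_comm] at hlt
  set a : I → ℝ := fun i => (∑ j ∈ S, x i j) * c / m i with ha
  have ham : ∀ i, m i * a i = (∑ j ∈ S, x i j) * c := by
    intro i
    have := (hm i).ne'
    simp only [ha]; field_simp
  have har : ∀ i, a i ≤ r i := by
    intro i
    have hsub : ∑ j ∈ S, x i j ≤ ∑ b, x i b :=
      Finset.sum_le_sum_of_subset_of_nonneg (Finset.subset_univ _) (fun b _ _ => h1 i b)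
    have : m i * a i ≤ m i * r i := by
      rw [ham, ← hr]; exact mul_le_mul_of_nonneg_right hsub hc.le
    exact le_of_mul_le_mul_left this (hm i)
  have hsumA : ∑ i ∈ T, m i * a i = c * S.card := by
    simp only [ham]
    rw [← Finset.sum_mul, Finset.sum_comm]
    have : ∀ j ∈ S, ∑ i ∈ T, x i j = 1 := by
      intro j hj
      have := eT (fun _ => 1) j hj
      simp only [mul_one] at this
      rw [← this, h2]
    rw [Finset.sum_congr rfl this]
    simp [mul_comm]
  have hge : ∀ i ∈ T, m i * (η * (η / (1 - η)) + (1 / (1 - η) ^ 2 - 1) * (a i - η)) ≤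
      c * ∑ j ∈ S, x i j * (r i / (1 - r i)) := by
    intro i _
    have e : c * ∑ j ∈ S, x i j * (r i / (1 - r i)) = m i * a i * (r i / (1 - r i)) := by
      rw [ham, ← Finset.sum_mul]; ring
    rw [e]
    have t := tangent (a i) η (lt_of_le_of_lt (har i) (hr1 i)) hη
    have hma : 0 ≤ m i * a i := by
      rw [ham]; exact mul_nonneg (Finset.sum_nonneg fun j _ => h1 i j) hc.le
    calc _ ≤ m i * (a i * (a i / (1 - a i))) := mul_le_mul_of_nonneg_left t (hm i).le
      _ = m i * a i * (a i / (1 - a i)) := by ring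
      _ ≤ _ := mul_le_mul_of_nonneg_left (frac_mono (har i) (hr1 i)) hma
  have hsum := Finset.sum_le_sum hge
  rw [← Finset.mul_sum] at hsum
  have hl : ∑ i ∈ T, m i * (η * (η / (1 - η)) + (1 / (1 - η) ^ 2 - 1) * (a i - η))
      = c * (S.card * (η / (1 - η))) := by
    have : ∀ i ∈ T, m i * (η * (η / (1 - η)) + (1 / (1 - η) ^ 2 - 1) * (a i - η))
      = m i * (η * (η / (1 - η)) - (1 / (1 - η) ^ 2 - 1) * η) +
        (m i * a i) * (1 / (1 - η) ^ 2 - 1) := fun i _ => by ring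
    rw [Finset.sum_congr rfl this, Finset.sum_add_distrib, ← Finset.sum_mul, ← Finset.sum_mul,
      hsumA, ← heq]
    rw [← mul_assoc c, ← heq]
    ring
  rw [hl] at hsum
  have := le_of_mul_le_mul_left hsum hc
  rw [Finset.sum_const, nsmul_eq_mul] at hlt
  linarith

/-- **Optimality transfer in the uniform case (κ = 1).** In the uniform case,
if `x*` is feasible with `max_i ρ_i(x*) = η_s* < 1`, then
`max_j w̄_j(x*) = η_t*`: an optimal solution of Program P_B is also an optimal
solution of Program P_A. -/
theorem opt_transfer_uniform
    {I J : Type*} [Fintype I] [Fintype J] [Nonempty I] [Nonempty J]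
    (E : I → J → Prop) [∀ i j, Decidable (E i j)]
    (lam : J → ℝ) (mu : I → J → ℝ)
    (hlam : ∀ j, 0 < lam j) (hmu : ∀ i j, E i j → 0 < mu i j)
    (hEj : ∀ j, ∃ i, E i j) (hEi : ∀ i, ∃ j, E i j)
    (lam0 : ℝ) (hlam0 : 0 < lam0) (hlamu : ∀ j, lam j = lam0)
    (mui : I → ℝ) (hmui : ∀ i, 0 < mui i)
    (hmuu : ∀ i j, E i j → mu i j = mui i)
    (xs : I → J → ℝ) (hxs : Feasible E lam mu xs)
    (hopt : (⨆ i, rho E lam mu xs i) = etaS E lam mu)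
    (hetaS : etaS E lam mu < 1) :
    (⨆ j, wbar E lam mu xs j) = etaT E lam mu := by
  have sumE : ∀ x : I → J → ℝ, (∀ i j, ¬ E i j → x i j = 0) → ∀ j,
      ∑ i ∈ univ.filter (fun i => E i j), x i j = ∑ i, x i j := by
    intro x hx j
    apply Finset.sum_subset (Finset.subset_univ _)
    intro i _ hi
    exact hx i j (by simpa using hi)
  have rhoE : ∀ x : I → J → ℝ, (∀ i j, ¬ E i j → x i j = 0) → ∀ i,
      (∑ b, x i b) * lam0 = mui i * rho E lam mu x i := by
    intro x hx i
    have h1 : rho E lam mu x i = ∑ l ∈ univ.filter (fun l => E i l), x i l * (lam0 / mui i) := by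
      unfold rho
      refine Finset.sum_congr rfl fun l hl => ?_
      rw [hlamu, hmuu i l (by simpa using hl)]; ring
    have h2 : ∑ l ∈ univ.filter (fun l => E i l), x i l = ∑ l, x i l := by
      apply Finset.sum_subset (Finset.subset_univ _)
      intro l _ hl
      exact hx i l (by simpa using hl)
    rw [h1, ← Finset.sum_mul, h2]
    have := (hmui i).ne'
    field_simp
  have wE : ∀ x : I → J → ℝ, (∀ i j, ¬ E i j → x i j = 0) → ∀ j,
      wbar E lam mu x j =
        ∑ i, x i j * (rho E lam mu x i / (1 - rho E lam mu x i)) := by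
    intro x hx j
    have h1 : wbar E lam mu x j = ∑ i ∈ univ.filter (fun i => E i j),
        x i j * (rho E lam mu x i / (1 - rho E lam mu x i)) := by
      unfold wbar
      refine Finset.sum_congr rfl fun i hi => ?_
      have hE : E i j := by simpa using hi
      have h2 : mu i j * (∑ l ∈ univ.filter (fun l => E i l), x i l * lam l / (mu i l) ^ 2)
          = rho E lam mu x i := by
        unfold rho
        rw [Finset.mul_sum]
        refine Finset.sum_congr rfl fun l hl => ?_
        rw [hmuu i j hE, hmuu i l (by simpa using hl)]
        have := (hmui i).ne'
        field_simp
      rw [← h2]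
      conv_rhs => rw [mul_div_assoc, ← mul_assoc]
      rw [h2]; rfl
    rw [h1]
    apply Finset.sum_subset (Finset.subset_univ _)
    intro i _ hi
    rw [hx i j (by simpa using hi), zero_mul]
  have allocF : ∀ x, Feasible E lam mu x → Alloc E x := fun x hx =>
    ⟨hx.1, fun i j => (hx.2.1 i j).1, fun j => by rw [← sumE x hx.1 j]; exact hx.2.2.1 j⟩
  set η := etaS E lam mu with hηd
  have hle : ∀ i, rho E lam mu xs i ≤ η := by
    intro i
    rw [← hopt]
    exact le_ciSup (Set.finite_range _).bddAbove i
  have hxsA := allocF xs hxs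
  have rho_nonneg : ∀ x, Alloc E x → ∀ i, 0 ≤ rho E lam mu x i := by
    intro x hx i
    have h := rhoE x hx.1 i
    have : 0 ≤ mui i * rho E lam mu x i := by
      rw [← h]; exact mul_nonneg (Finset.sum_nonneg fun b _ => hx.2.1 i b) hlam0.le
    exact nonneg_of_mul_nonneg_right this (hmui i)
  obtain ⟨S, T, hS, hST, heq⟩ := bottleneck E lam0 hlam0 mui hmui η xs hxsA
    (fun i => by
      rw [rhoE xs hxs.1 i]; exact mul_le_mul_of_nonneg_left (hle i) (hmui i).le)
    (by
      intro x hx hxle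
      have hr : ∀ i, rho E lam mu x i ≤ η := fun i => by
        have := hxle i
        rw [rhoE x hx.1 i] at this
        exact le_of_mul_le_mul_left this (hmui i)
      have hF : Feasible E lam mu x := by
        refine ⟨hx.1, fun i j => ⟨hx.2.1 i j, ?_⟩, fun j => ?_, fun i => (hr i).trans hetaS.le⟩
        · rw [← hx.2.2 j]
          exact Finset.single_le_sum (f := fun i => x i j) (fun b _ => hx.2.1 b j) (mem_univ i)
        · rw [sumE x hx.1 j]; exact hx.2.2 j
      obtain ⟨i, hi⟩ := exists_eq_ciSup_of_finite (f := fun i => rho E lam mu x i)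
      have hinf : η ≤ ⨆ i, rho E lam mu x i := by
        apply csInf_le
        · refine ⟨0, ?_⟩
          rintro _ ⟨y, hy, rfl⟩
          exact Real.iSup_nonneg (rho_nonneg y (allocF y hy))
        · exact ⟨x, hF, rfl⟩
      refine ⟨i, ?_⟩
      rw [rhoE x hx.1 i, le_antisymm (hr i) (hi ▸ hinf)])
  have hlow : ∀ x, StrictFeasible E lam mu x → η / (1 - η) ≤ ⨆ j, wbar E lam mu x j := by
    intro x hx
    obtain ⟨j, hj⟩ := lower E lam0 hlam0 mui hmui η hetaS S T hS hST heq x (allocF x hx.1)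
      (rho E lam mu x) (rhoE x hx.1.1) hx.2
    rw [← wE x hx.1.1 j] at hj
    exact hj.trans (le_ciSup (f := fun j => wbar E lam mu x j) (Set.finite_range _).bddAbove j)
  have hxsS : StrictFeasible E lam mu xs := ⟨hxs, fun i => (hle i).trans_lt hetaS⟩
  have hup : (⨆ j, wbar E lam mu xs j) ≤ η / (1 - η) := by
    apply ciSup_le
    intro j
    rw [wE xs hxs.1 j]
    calc _ ≤ ∑ i, xs i j * (η / (1 - η)) := Finset.sum_le_sum fun i _ =>
          mul_le_mul_of_nonneg_left (frac_mono (hle i) hetaS) (hxsA.2.1 i j)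
      _ = _ := by rw [← Finset.sum_mul, hxsA.2.2 j, one_mul]
  apply le_antisymm
  · apply le_csInf
    · exact ⟨_, xs, hxsS, rfl⟩
    · rintro _ ⟨y, hy, rfl⟩
      exact hup.trans (hlow y hy)
  · apply csInf_le
    · refine ⟨η / (1 - η), ?_⟩
      rintro _ ⟨y, hy, rfl⟩
      exact hlow y hy
    · exact ⟨xs, hxsS, rfl⟩
end

section
/- Neighborhood lower bound on waiting times (uniform case): Assume the uniform case, i.e. there are μ_i > 0 with μ_{ij} = μ_i for every j ∼ i, and λ_j = λ > 0 for every j ∈ J. Let S ⊆ J be nonempty, let ∂(S) := { i ∈ I : ∃ j ∈ S with i ∼ j }, λ(S) := λ · |S|, μ(S) := ∑_{i ∈ ∂(S)} μ_i, and assume λ(S) < μ(S). Then for every strictly feasible x, max_{j ∈ J} ((∑_{i ∼ j} x_{ij} / (1 − ρ_i(x))) − 1) + 1 ≥ 1/(1 − λ(S)/μ(S)); consequently η̄_t* + 1 ≥ 1/(1 − λ(S)/μ(S)). -/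
open Finset

/-- **Neighborhood lower bound on waiting times (uniform case).** For every
nonempty `S ⊆ J` with `λ(S) < μ(S)`, every strictly feasible `x` has
P̄_A-objective `+ 1` at least `1/(1 − λ(S)/μ(S))`; consequently
`η̄_t* + 1 ≥ 1/(1 − λ(S)/μ(S))` (assuming, as in the paper, that a strictly
feasible solution exists). -/
theorem neighborhood_lower_bound_uniform
    {I J : Type*} [Fintype I] [Fintype J] [Nonempty I] [Nonempty J]
    (E : I → J → Prop) [∀ i j, Decidable (E i j)]
    (lam : J → ℝ) (mu : I → J → ℝ)
    (hlam : ∀ j, 0 < lam j) (hmu : ∀ i j, E i j → 0 < mu i j)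
    (hEj : ∀ j, ∃ i, E i j) (hEi : ∀ i, ∃ j, E i j)
    (lam0 : ℝ) (hlam0 : 0 < lam0) (hlamu : ∀ j, lam j = lam0)
    (mui : I → ℝ) (hmui : ∀ i, 0 < mui i)
    (hmuu : ∀ i j, E i j → mu i j = mui i)
    (S : Finset J) (hS : S.Nonempty)
    (hSlt : lam0 * S.card < ∑ i ∈ univ.filter (fun i => ∃ j ∈ S, E i j), mui i)
    (hex : ∃ x, StrictFeasible E lam mu x) :
    (∀ x, StrictFeasible E lam mu x →
      (⨆ j, (∑ i ∈ univ.filter (fun i => E i j), x i j / (1 - rho E lam mu x i)) - 1) + 1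
        ≥ 1 / (1 - lam0 * S.card /
            ∑ i ∈ univ.filter (fun i => ∃ j ∈ S, E i j), mui i)) ∧
    etaTbar E lam mu + 1 ≥
      1 / (1 - lam0 * S.card /
        ∑ i ∈ univ.filter (fun i => ∃ j ∈ S, E i j), mui i) := by
  have key : ∀ x, StrictFeasible E lam mu x →
      (⨆ j, (∑ i ∈ univ.filter (fun i => E i j), x i j / (1 - rho E lam mu x i)) - 1) + 1
        ≥ 1 / (1 - lam0 * S.card /
            ∑ i ∈ univ.filter (fun i => ∃ j ∈ S, E i j), mui i) := by
    intro x hx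
    obtain ⟨⟨hx0, hx1, hxs, -⟩, hxr⟩ := hx
    set D := univ.filter (fun i => ∃ j ∈ S, E i j) with hD
    set m := ∑ i ∈ D, mui i with hm
    set M := (⨆ j, (∑ i ∈ univ.filter (fun i => E i j),
      x i j / (1 - rho E lam mu x i)) - 1) + 1 with hM
    have hc : (0 : ℝ) < S.card := by exact_mod_cast hS.card_pos
    have hL : 0 < lam0 * S.card := mul_pos hlam0 hc
    have hm0 : 0 < m := hL.trans hSlt
    have hsub : ∀ j ∈ S, univ.filter (fun i => E i j) ⊆ D := by
      intro j hj i hi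
      simp only [hD, mem_filter, mem_univ, true_and] at hi ⊢
      exact ⟨j, hj, hi⟩
    have hMj : ∀ j ∈ S, ∑ i ∈ D, x i j / (1 - rho E lam mu x i) ≤ M := by
      intro j hj
      have h1 : ∑ i ∈ univ.filter (fun i => E i j), x i j / (1 - rho E lam mu x i)
          = ∑ i ∈ D, x i j / (1 - rho E lam mu x i) := by
        apply sum_subset (hsub j hj)
        intro i _ hi
        rw [hx0 i j (by simpa using hi), zero_div]
      rw [← h1]
      have h2 := le_ciSup (f := fun j => (∑ i ∈ univ.filter (fun i => E i j),
        x i j / (1 - rho E lam mu x i)) - 1) (Set.finite_range _).bddAbove j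
      linarith
    have hxD : ∀ j ∈ S, ∑ i ∈ D, x i j = 1 := by
      intro j hj
      rw [← hxs j]
      symm
      apply sum_subset (hsub j hj)
      intro i _ hi
      exact hx0 i j (by simpa using hi)
    let y : I → ℝ := fun i => ∑ j ∈ S, x i j
    have hy0 : ∀ i, 0 ≤ y i := fun i => sum_nonneg fun j _ => (hx1 i j).1
    have hysum : ∑ i ∈ D, y i = S.card := by
      simp only [y]
      rw [sum_comm, sum_congr rfl hxD]
      simp
    have hyM : ∑ i ∈ D, y i / (1 - rho E lam mu x i) ≤ S.card * M := by
      simp only [y, sum_div]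
      rw [sum_comm]
      calc _ ≤ ∑ j ∈ S, M := sum_le_sum hMj
        _ = _ := by simp
    have hrho : ∀ i, lam0 * y i / mui i ≤ rho E lam mu x i := by
      intro i
      have h1 : rho E lam mu x i = ∑ l, x i l * lam0 / mui i := by
        unfold rho
        rw [sum_filter]
        apply sum_congr rfl
        intro l _
        split_ifs with h
        · rw [hlamu, hmuu i l h]
        · rw [hx0 i l h]; simp
      rw [h1]
      have h2 : lam0 * y i / mui i = ∑ l ∈ S, x i l * lam0 / mui i := by
        simp only [y]
        rw [mul_sum, sum_div]
        exact sum_congr rfl fun l _ => by ring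
      rw [h2]
      apply sum_le_sum_of_subset_of_nonneg (subset_univ _)
      intro l _ _
      exact div_nonneg (mul_nonneg (hx1 i l).1 hlam0.le) (hmui i).le
    set r := lam0 * S.card / m with hr
    have hr1 : 0 < 1 - r := by
      have : r < 1 := (div_lt_one hm0).2 hSlt
      linarith
    have hrm : r * m = lam0 * S.card := by rw [hr]; field_simp
    have htan : ∀ i, mui i * (r / (1 - r)) + (lam0 * y i - mui i * r) / (1 - r) ^ 2
        ≤ lam0 * (y i / (1 - rho E lam mu x i)) := by
      intro i
      have hri := hxr i
      have ht := hrho i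
      set t := lam0 * y i / mui i with htd
      have hmi := hmui i
      have hty : lam0 * y i = mui i * t := by rw [htd]; field_simp
      have h1t : 0 < 1 - t := by linarith
      calc _ = mui i * (r / (1 - r) + (t - r) / (1 - r) ^ 2) := by rw [hty]; ring
        _ ≤ mui i * (t / (1 - t)) := by
          apply mul_le_mul_of_nonneg_left _ hmi.le
          have : t / (1 - t) - (r / (1 - r) + (t - r) / (1 - r) ^ 2)
              = (t - r) ^ 2 / ((1 - t) * (1 - r) ^ 2) := by
            field_simp
            ring
          have : 0 ≤ (t - r) ^ 2 / ((1 - t) * (1 - r) ^ 2) := by positivity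
          linarith
        _ = lam0 * y i / (1 - t) := by rw [hty]; ring
        _ ≤ lam0 * y i / (1 - rho E lam mu x i) := by
          apply div_le_div_of_nonneg_left (mul_nonneg hlam0.le (hy0 i)) <;> linarith
        _ = _ := by ring
    have hfin := sum_le_sum (s := D) fun i _ => htan i
    rw [sum_add_distrib, ← sum_mul, ← sum_div, sum_sub_distrib, ← mul_sum, ← mul_sum,
      ← sum_mul, hysum, ← hm, mul_comm m r, hrm, sub_self, zero_div, add_zero] at hfin
    have h3 : lam0 * S.card * (1 / (1 - r)) ≤ lam0 * S.card * M := by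
      calc _ = m * (r / (1 - r)) := by rw [← hrm]; ring
        _ ≤ _ := hfin
        _ ≤ lam0 * (S.card * M) := mul_le_mul_of_nonneg_left hyM hlam0.le
        _ = _ := by ring
    exact le_of_mul_le_mul_left h3 hL
  refine ⟨key, ?_⟩
  have : 1 / (1 - lam0 * S.card / ∑ i ∈ univ.filter (fun i => ∃ j ∈ S, E i j), mui i) - 1
      ≤ etaTbar E lam mu := by
    unfold etaTbar
    apply le_csInf
    · obtain ⟨x, hx⟩ := hex
      exact ⟨_, x, hx, rfl⟩
    · rintro _ ⟨x, hx, rfl⟩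
      have := key x hx
      simp only
      linarith
  linarith
end

section
/- Comparison of task-fairness optima under rate homogenization: Let (I,J,E,λ,μ) be a bipartite instance with λ_j = λ > 0 for every j ∈ J, let κ := max_{i ∈ I} max_{j ∼ i, j' ∼ i} μ_{ij}/μ_{ij'}, and let μ̄ be the homogenized instance with μ̄_{ij} := max_{j' ∼ i} μ_{ij'} for every (i,j) ∈ E (same I, J, E, λ). Then η_t*(μ) ≥ η_t*(μ̄)/κ, where η_t*(μ) and η_t*(μ̄) denote the optimal values of Program P_A for the instances with service rates μ and μ̄ respectively. -/
open Finset

/-- **Comparison of task-fairness optima under rate homogenization.** With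
uniform arrival rates, `κ = max_i max_{j ∼ i, j' ∼ i} μ_{ij}/μ_{ij'}`, and the
homogenized rates `μ̄_{ij} = max_{j' ∼ i} μ_{ij'}`, one has
`η_t*(μ) ≥ η_t*(μ̄)/κ`. -/
theorem homogenization_task_fairness
    {I J : Type*} [Fintype I] [Fintype J] [Nonempty I] [Nonempty J]
    (E : I → J → Prop) [∀ i j, Decidable (E i j)]
    (lam : J → ℝ) (mu : I → J → ℝ)
    (hlam : ∀ j, 0 < lam j) (hmu : ∀ i j, E i j → 0 < mu i j)
    (hEj : ∀ j, ∃ i, E i j) (hEi : ∀ i, ∃ j, E i j)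
    (lam0 : ℝ) (hlam0 : 0 < lam0) (hlamu : ∀ j, lam j = lam0)
    (kappa : ℝ)
    (hkappa : kappa = ⨆ p : {p : I × J × J // E p.1 p.2.1 ∧ E p.1 p.2.2},
        mu p.1.1 p.1.2.1 / mu p.1.1 p.1.2.2)
    (mubar : I → J → ℝ)
    (hmubar : ∀ i j, E i j → mubar i j = ⨆ j' : {j' : J // E i j'}, mu i j'.1)
    (hex : ∃ x, StrictFeasible E lam mu x) :
    etaT E lam mu ≥ etaT E lam mubar / kappa := by
  classical
  have hkle : ∀ i j j', E i j → E i j' → mu i j / mu i j' ≤ kappa := by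
    intro i j j' h h'
    rw [hkappa]
    exact le_ciSup (f := fun p : {p : I × J × J // E p.1 p.2.1 ∧ E p.1 p.2.2} =>
      mu p.1.1 p.1.2.1 / mu p.1.1 p.1.2.2) (Set.finite_range _).bddAbove ⟨(i, j, j'), h, h'⟩
  have hkpos : 0 < kappa := by
    obtain ⟨i⟩ := ‹Nonempty I›
    obtain ⟨j, hj⟩ := hEi i
    exact lt_of_lt_of_le (div_pos (hmu i j hj) (hmu i j hj)) (hkle i j j hj hj)
  have hm : ∀ i, ∃ m, (∀ j, E i j → mubar i j = m) ∧ (∀ j, E i j → mu i j ≤ m) ∧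
      0 < m ∧ (∀ j, E i j → m ≤ kappa * mu i j) := by
    intro i
    obtain ⟨j0, hj0⟩ := hEi i
    have : Nonempty {j' : J // E i j'} := ⟨⟨j0, hj0⟩⟩
    have hle : ∀ j, E i j → mu i j ≤ ⨆ j' : {j' : J // E i j'}, mu i j'.1 := fun j hj =>
      le_ciSup (f := fun j' : {j' : J // E i j'} => mu i j'.1)
        (Set.finite_range _).bddAbove ⟨j, hj⟩
    refine ⟨_, hmubar i, hle, lt_of_lt_of_le (hmu i j0 hj0) (hle j0 hj0), ?_⟩
    intro j hj
    refine ciSup_le ?_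
    rintro ⟨j', hj'⟩
    exact (div_le_iff₀ (hmu i j hj)).1 (hkle i j' j hj' hj)
  choose m hm1 hm2 hm3 hm4 using hm
  have hrho : ∀ x : I → J → ℝ, (∀ i j, 0 ≤ x i j) → ∀ i,
      rho E lam mubar x i ≤ rho E lam mu x i := by
    intro x hx i
    unfold rho
    refine Finset.sum_le_sum fun l hl => ?_
    have hl' : E i l := by simpa using hl
    rw [hm1 i l hl']
    exact div_le_div_of_nonneg_left (mul_nonneg (hx i l) (hlam l).le) (hmu i l hl') (hm2 i l hl')
  have hSF : ∀ x, StrictFeasible E lam mu x → StrictFeasible E lam mubar x := by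
    rintro x ⟨⟨h1, h2, h3, h4⟩, h5⟩
    have := hrho x (fun i j => (h2 i j).1)
    exact ⟨⟨h1, h2, h3, fun i => (this i).trans (h4 i)⟩, fun i => (this i).trans_lt (h5 i)⟩
  have hw0 : ∀ x, StrictFeasible E lam mubar x → ∀ j, 0 ≤ wbar E lam mubar x j := by
    rintro x ⟨⟨h1, h2, h3, h4⟩, h5⟩ j
    unfold wbar
    refine Finset.sum_nonneg fun i hi => ?_
    have hi' : E i j := by simpa using hi
    have hr := h5 i
    unfold rho at hr
    refine mul_nonneg (mul_nonneg (h2 i j).1 (by rw [hm1 i j hi']; exact (hm3 i).le))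
      (div_nonneg (Finset.sum_nonneg fun l _ => ?_) (by linarith))
    exact div_nonneg (mul_nonneg (h2 i l).1 (hlam l).le) (sq_nonneg _)
  have hw : ∀ x, StrictFeasible E lam mu x → ∀ j,
      wbar E lam mubar x j ≤ kappa * wbar E lam mu x j := by
    rintro x ⟨⟨h1, h2, h3, h4⟩, h5⟩ j
    unfold wbar
    rw [Finset.mul_sum]
    refine Finset.sum_le_sum fun i hi => ?_
    have hi' : E i j := by simpa using hi
    have hr := h5 i
    have hr2 := hrho x (fun i j => (h2 i j).1) i
    unfold rho at hr hr2
    have hs : ∑ l ∈ univ.filter (fun l => E i l), x i l * lam l / (mubar i l) ^ 2 ≤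
        ∑ l ∈ univ.filter (fun l => E i l), x i l * lam l / (mu i l) ^ 2 := by
      refine Finset.sum_le_sum fun l hl => ?_
      have hl' : E i l := by simpa using hl
      rw [hm1 i l hl']
      exact div_le_div_of_nonneg_left (mul_nonneg (h2 i l).1 (hlam l).le)
        (pow_pos (hmu i l hl') 2) (pow_le_pow_left₀ (hmu i l hl').le (hm2 i l hl') 2)
    have hs0 : 0 ≤ ∑ l ∈ univ.filter (fun l => E i l), x i l * lam l / (mubar i l) ^ 2 :=
      Finset.sum_nonneg fun l _ =>
        div_nonneg (mul_nonneg (h2 i l).1 (hlam l).le) (sq_nonneg _)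
    have hd := div_le_div₀ (hs0.trans hs) hs (sub_pos.2 hr) (sub_le_sub_left hr2 1)
    have hd0 := div_nonneg hs0 (sub_pos.2 (hr2.trans_lt hr)).le
    rw [← mul_assoc]
    refine mul_le_mul ?_ hd hd0 ?_
    · rw [hm1 i j hi']
      have := mul_le_mul_of_nonneg_left (hm4 i j hi') (h2 i j).1
      linarith
    · exact mul_nonneg hkpos.le (mul_nonneg (h2 i j).1 (hmu i j hi').le)
  rw [ge_iff_le, div_le_iff₀ hkpos, mul_comm, ← div_le_iff₀' hkpos]
  unfold etaT
  refine le_csInf (Set.Nonempty.image _ hex) ?_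
  rintro _ ⟨x, hx, rfl⟩
  rw [div_le_iff₀' hkpos]
  refine le_trans (csInf_le ?_ (Set.mem_image_of_mem _ (show x ∈ {x | StrictFeasible E lam mubar x} from hSF x hx))) ?_
  · refine ⟨0, ?_⟩
    rintro _ ⟨y, hy, rfl⟩
    exact Real.iSup_nonneg (hw0 y hy)
  · refine ciSup_le fun j => (hw x hx j).trans ?_
    exact mul_le_mul_of_nonneg_left (le_ciSup (f := fun j => wbar E lam mu x j)
      (Set.finite_range _).bddAbove j) hkpos.le
end

section
/- Comparison of worker-fairness optima under rate homogenization: Let (I,J,E,λ,μ) be a bipartite instance with λ_j = λ > 0 for every j ∈ J and a nonempty feasible set, let κ := max_{i ∈ I} max_{j ∼ i, j' ∼ i} μ_{ij}/μ_{ij'}, and let μ̄ be the homogenized instance with μ̄_{ij} := max_{j' ∼ i} μ_{ij'} for every (i,j) ∈ E (same I, J, E, λ). Then η_s*(μ̄) ≥ η_s*(μ)/κ, where η_s*(μ) and η_s*(μ̄) denote the optimal values of Program P_B for the instances with service rates μ and μ̄ respectively. -/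
open Finset

/-- **Comparison of worker-fairness optima under rate homogenization.** With
uniform arrival rates, a nonempty feasible set,
`κ = max_i max_{j ∼ i, j' ∼ i} μ_{ij}/μ_{ij'}`, and the homogenized rates
`μ̄_{ij} = max_{j' ∼ i} μ_{ij'}`, one has `η_s*(μ̄) ≥ η_s*(μ)/κ`. -/
theorem homogenization_worker_fairness
    {I J : Type*} [Fintype I] [Fintype J] [Nonempty I] [Nonempty J]
    (E : I → J → Prop) [∀ i j, Decidable (E i j)]
    (lam : J → ℝ) (mu : I → J → ℝ)
    (hlam : ∀ j, 0 < lam j) (hmu : ∀ i j, E i j → 0 < mu i j)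
    (hEj : ∀ j, ∃ i, E i j) (hEi : ∀ i, ∃ j, E i j)
    (lam0 : ℝ) (hlam0 : 0 < lam0) (hlamu : ∀ j, lam j = lam0)
    (hex : ∃ x, Feasible E lam mu x)
    (kappa : ℝ)
    (hkappa : kappa = ⨆ p : {p : I × J × J // E p.1 p.2.1 ∧ E p.1 p.2.2},
        mu p.1.1 p.1.2.1 / mu p.1.1 p.1.2.2)
    (mubar : I → J → ℝ)
    (hmubar : ∀ i j, E i j → mubar i j = ⨆ j' : {j' : J // E i j'}, mu i j'.1) :
    etaS E lam mubar ≥ etaS E lam mu / kappa := by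
  classical
  have hbar_ge : ∀ i j, E i j → mu i j ≤ mubar i j := by
    intro i j h
    rw [hmubar i j h]
    exact le_ciSup (f := fun j' : {j' : J // E i j'} => mu i j'.1)
      (Set.finite_range _).bddAbove ⟨j, h⟩
  have hk : ∀ i j j', E i j → E i j' → mu i j / mu i j' ≤ kappa := by
    intro i j j' h h'
    rw [hkappa]
    exact le_ciSup (f := fun p : {p : I × J × J // E p.1 p.2.1 ∧ E p.1 p.2.2} =>
      mu p.1.1 p.1.2.1 / mu p.1.1 p.1.2.2) (Set.finite_range _).bddAbove ⟨(i, j, j'), h, h'⟩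
  have hkpos : 0 < kappa := by
    obtain ⟨i⟩ := ‹Nonempty I›
    obtain ⟨j, h⟩ := hEi i
    exact lt_of_lt_of_le (div_pos (hmu i j h) (hmu i j h)) (hk i j j h h)
  have hbar_le : ∀ i j, E i j → mubar i j ≤ kappa * mu i j := by
    intro i j h
    rw [hmubar i j h]
    haveI : Nonempty {j' : J // E i j'} := ⟨⟨j, h⟩⟩
    apply ciSup_le
    rintro ⟨j', h'⟩
    exact (div_le_iff₀ (hmu i j h)).1 (hk i j' j h' h)
  have hrho1 : ∀ x : I → J → ℝ, (∀ i j, 0 ≤ x i j) → ∀ i,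
      rho E lam mubar x i ≤ rho E lam mu x i := by
    intro x hx i
    unfold rho
    apply Finset.sum_le_sum
    intro l hl
    have h : E i l := (Finset.mem_filter.1 hl).2
    exact div_le_div_of_nonneg_left (mul_nonneg (hx i l) (hlam l).le) (hmu i l h) (hbar_ge i l h)
  have hrho2 : ∀ x : I → J → ℝ, (∀ i j, 0 ≤ x i j) → ∀ i,
      rho E lam mu x i ≤ kappa * rho E lam mubar x i := by
    intro x hx i
    unfold rho
    rw [Finset.mul_sum]
    apply Finset.sum_le_sum
    intro l hl
    have h : E i l := (Finset.mem_filter.1 hl).2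
    have h1 := hmu i l h
    have h2 : 0 < mubar i l := lt_of_lt_of_le h1 (hbar_ge i l h)
    have h3 := hbar_le i l h
    have h4 := mul_nonneg (hx i l) (hlam l).le
    rw [← mul_div_assoc, div_le_div_iff₀ h1 h2]
    calc x i l * lam l * mubar i l ≤ x i l * lam l * (kappa * mu i l) :=
          mul_le_mul_of_nonneg_left h3 h4
      _ = _ := by ring
  have hbdd : BddBelow ((fun x => ⨆ i, rho E lam mu x i) '' {x | Feasible E lam mu x}) := by
    refine ⟨0, ?_⟩
    rintro _ ⟨x, hx, rfl⟩
    apply Real.iSup_nonneg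
    intro i
    unfold rho
    apply Finset.sum_nonneg
    intro l hl
    have h : E i l := (Finset.mem_filter.1 hl).2
    exact div_nonneg (mul_nonneg (hx.2.1 i l).1 (hlam l).le) (hmu i l h).le
  have heta1 : etaS E lam mu ≤ 1 := by
    obtain ⟨x, hx⟩ := hex
    exact (csInf_le hbdd ⟨x, hx, rfl⟩).trans (ciSup_le hx.2.2.2)
  change etaS E lam mu / kappa ≤ etaS E lam mubar
  rw [etaS.eq_def E lam mubar]
  apply le_csInf
  · obtain ⟨x, hx⟩ := hex
    exact ⟨_, x, ⟨hx.1, hx.2.1, hx.2.2.1, fun i =>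
      (hrho1 x (fun i j => (hx.2.1 i j).1) i).trans (hx.2.2.2 i)⟩, rfl⟩
  · rintro _ ⟨x, hx, rfl⟩
    have hx0 : ∀ i j, 0 ≤ x i j := fun i j => (hx.2.1 i j).1
    rw [div_le_iff₀' hkpos]
    have hup : ∀ i, rho E lam mu x i ≤ kappa * ⨆ i, rho E lam mubar x i := fun i =>
      (hrho2 x hx0 i).trans (mul_le_mul_of_nonneg_left
        (le_ciSup (f := fun i => rho E lam mubar x i) (Set.finite_range _).bddAbove i) hkpos.le)
    by_cases hf : ∀ i, rho E lam mu x i ≤ 1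
    · exact (csInf_le hbdd ⟨x, ⟨hx.1, hx.2.1, hx.2.2.1, hf⟩, rfl⟩).trans (ciSup_le hup)
    · push Not at hf
      obtain ⟨i, hi⟩ := hf
      exact heta1.trans (hi.le.trans (hup i))
end

section
/- κ-upper sandwich for waiting times: Let (I,J,E,λ,μ) be a bipartite instance and let κ := max_{i ∈ I} max_{j ∼ i, j' ∼ i} μ_{ij}/μ_{ij'}. Then for every strictly feasible x and every j ∈ J, w̄_j(x) ≤ κ · ∑_{i ∼ j} x_{ij} · (ρ_i(x)/(1 − ρ_i(x))), and consequently max_{j ∈ J} w̄_j(x) ≤ κ · (1/(1 − max_{i ∈ I} ρ_i(x)) − 1). -/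
open Finset

/-- **κ-upper sandwich for waiting times.** For every strictly feasible `x` and
every `j`, `w̄_j(x) ≤ κ ∑_{i ∼ j} x_{ij} ρ_i(x)/(1 − ρ_i(x))`, and consequently
`max_j w̄_j(x) ≤ κ (1/(1 − max_i ρ_i(x)) − 1)`. -/
theorem kappa_upper_sandwich
    {I J : Type*} [Fintype I] [Fintype J] [Nonempty I] [Nonempty J]
    (E : I → J → Prop) [∀ i j, Decidable (E i j)]
    (lam : J → ℝ) (mu : I → J → ℝ)
    (hlam : ∀ j, 0 < lam j) (hmu : ∀ i j, E i j → 0 < mu i j)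
    (hEj : ∀ j, ∃ i, E i j) (hEi : ∀ i, ∃ j, E i j)
    (kappa : ℝ)
    (hkappa : kappa = ⨆ p : {p : I × J × J // E p.1 p.2.1 ∧ E p.1 p.2.2},
        mu p.1.1 p.1.2.1 / mu p.1.1 p.1.2.2) :
    (∀ x, StrictFeasible E lam mu x → ∀ j,
      wbar E lam mu x j ≤
        kappa * ∑ i ∈ univ.filter (fun i => E i j),
          x i j * (rho E lam mu x i / (1 - rho E lam mu x i))) ∧
    (∀ x, StrictFeasible E lam mu x →
      (⨆ j, wbar E lam mu x j) ≤
        kappa * (1 / (1 - ⨆ i, rho E lam mu x i) - 1)) := by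
  have hk : ∀ i a b, E i a → E i b → mu i a / mu i b ≤ kappa := by
    intro i a b ha hb
    rw [hkappa]
    exact le_ciSup (f := fun p : {p : I × J × J // E p.1 p.2.1 ∧ E p.1 p.2.2} =>
      mu p.1.1 p.1.2.1 / mu p.1.1 p.1.2.2) (Set.finite_range _).bddAbove ⟨(i, a, b), ha, hb⟩
  have hk0 : 0 ≤ kappa := by
    obtain ⟨j⟩ := ‹Nonempty J›
    obtain ⟨i, hi⟩ := hEj j
    exact (div_pos (hmu i j hi) (hmu i j hi)).le.trans (hk i j j hi hi)
  have h1 : ∀ x, StrictFeasible E lam mu x → ∀ j,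
      wbar E lam mu x j ≤
        kappa * ∑ i ∈ univ.filter (fun i => E i j),
          x i j * (rho E lam mu x i / (1 - rho E lam mu x i)) := by
    intro x hx j
    obtain ⟨⟨-, h01, -, -⟩, hlt⟩ := hx
    unfold wbar
    rw [Finset.mul_sum]
    refine Finset.sum_le_sum fun i hi => ?_
    have hij : E i j := by simpa using hi
    have hpos : 0 < 1 - rho E lam mu x i := sub_pos.2 (hlt i)
    have key : mu i j * (∑ l ∈ univ.filter (fun l => E i l), x i l * lam l / (mu i l) ^ 2)
        ≤ kappa * rho E lam mu x i := by
      unfold rho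
      rw [Finset.mul_sum, Finset.mul_sum]
      refine Finset.sum_le_sum fun l hl => ?_
      have hil : E i l := by simpa using hl
      have hm := hmu i l hil
      have h0 : 0 ≤ x i l * lam l / mu i l :=
        div_nonneg (mul_nonneg (h01 i l).1 (hlam l).le) hm.le
      calc mu i j * (x i l * lam l / (mu i l) ^ 2)
          = mu i j / mu i l * (x i l * lam l / mu i l) := by field_simp
        _ ≤ _ := mul_le_mul_of_nonneg_right (hk i j l hij hil) h0
    change x i j * mu i j *
      ((∑ l ∈ univ.filter (fun l => E i l), x i l * lam l / (mu i l) ^ 2) /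
        (1 - rho E lam mu x i)) ≤ _
    calc _ = x i j * (mu i j * (∑ l ∈ univ.filter (fun l => E i l),
            x i l * lam l / (mu i l) ^ 2) / (1 - rho E lam mu x i)) := by ring
      _ ≤ x i j * (kappa * rho E lam mu x i / (1 - rho E lam mu x i)) :=
          mul_le_mul_of_nonneg_left (div_le_div_of_nonneg_right key hpos.le) (h01 i j).1
      _ = _ := by ring
  refine ⟨h1, fun x hx => ciSup_le fun j => (h1 x hx j).trans ?_⟩
  refine mul_le_mul_of_nonneg_left ?_ hk0
  obtain ⟨⟨-, h01, hsum, -⟩, hlt⟩ := hx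
  have hM : (⨆ i, rho E lam mu x i) < 1 := by
    obtain ⟨i, hi⟩ := exists_eq_ciSup_of_finite (f := fun i => rho E lam mu x i)
    rw [← hi]
    exact hlt i
  calc _ ≤ ∑ i ∈ univ.filter (fun i => E i j),
        x i j * (1 / (1 - ⨆ i, rho E lam mu x i) - 1) := by
        refine Finset.sum_le_sum fun i _ => mul_le_mul_of_nonneg_left ?_ (h01 i j).1
        have hpos : 0 < 1 - rho E lam mu x i := sub_pos.2 (hlt i)
        have hle : rho E lam mu x i ≤ ⨆ i, rho E lam mu x i :=
          le_ciSup (f := fun i => rho E lam mu x i) (Set.finite_range _).bddAbove i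
        have e : rho E lam mu x i / (1 - rho E lam mu x i)
            = 1 / (1 - rho E lam mu x i) - 1 := by
          field_simp
          ring
        rw [e]
        have := one_div_le_one_div_of_le (sub_pos.2 hM) (sub_le_sub_left hle 1)
        linarith
    _ = _ := by rw [← Finset.sum_mul, hsum j, one_mul]
end

section
/- κ-lower sandwich for waiting times: Let (I,J,E,λ,μ) be a bipartite instance, let κ := max_{i ∈ I} max_{j ∼ i, j' ∼ i} μ_{ij}/μ_{ij'}, and for each i ∈ I set μ_i := max_{j' ∼ i} μ_{ij'} and ρ̄_i(x) := ∑_{ℓ ∼ i} x_{iℓ} λ_ℓ / μ_i. Then for every strictly feasible x with ρ̄_i(x) < 1 for all i, and every j ∈ J, w̄_j(x) ≥ (1/κ) · ((∑_{i ∼ j} x_{ij} / (1 − ρ̄_i(x))) − 1), provided ∑_{i ∼ j} x_{ij} = 1. -/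
open Finset

/-- **κ-lower sandwich for waiting times.** With
`κ = max_i max_{j ∼ i, j' ∼ i} μ_{ij}/μ_{ij'}`, `μ_i = max_{j' ∼ i} μ_{ij'}` and
`ρ̄_i(x) = ∑_{ℓ ∼ i} x_{iℓ} λ_ℓ/μ_i`: for every strictly feasible `x` with
`ρ̄_i(x) < 1` for all `i`, and every `j` with `∑_{i ∼ j} x_{ij} = 1`,
`w̄_j(x) ≥ (1/κ)((∑_{i ∼ j} x_{ij}/(1 − ρ̄_i(x))) − 1)`. -/
theorem kappa_lower_sandwich
    {I J : Type*} [Fintype I] [Fintype J] [Nonempty I] [Nonempty J]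
    (E : I → J → Prop) [∀ i j, Decidable (E i j)]
    (lam : J → ℝ) (mu : I → J → ℝ)
    (hlam : ∀ j, 0 < lam j) (hmu : ∀ i j, E i j → 0 < mu i j)
    (hEj : ∀ j, ∃ i, E i j) (hEi : ∀ i, ∃ j, E i j)
    (kappa : ℝ)
    (hkappa : kappa = ⨆ p : {p : I × J × J // E p.1 p.2.1 ∧ E p.1 p.2.2},
        mu p.1.1 p.1.2.1 / mu p.1.1 p.1.2.2)
    (mui : I → ℝ) (hmui : ∀ i, mui i = ⨆ j' : {j' : J // E i j'}, mu i j'.1)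
    (x : I → J → ℝ) (hx : StrictFeasible E lam mu x)
    (hrhobar : ∀ i,
      (∑ l ∈ univ.filter (fun l => E i l), x i l * lam l / mui i) < 1)
    (j : J) (hxj : ∑ i ∈ univ.filter (fun i => E i j), x i j = 1) :
    wbar E lam mu x j ≥
      (1 / kappa) *
        ((∑ i ∈ univ.filter (fun i => E i j),
          x i j / (1 - ∑ l ∈ univ.filter (fun l => E i l), x i l * lam l / mui i)) - 1) := by
  obtain ⟨⟨-, hx01, -, -⟩, hrho⟩ := hx
  have hle : ∀ i l, E i l → mu i l ≤ mui i := by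
    intro i l h
    rw [hmui i]
    exact le_ciSup (f := fun j' : {j' : J // E i j'} => mu i j'.1)
      (Set.finite_range _).bddAbove ⟨l, h⟩
  have hk : ∀ i a b, E i a → E i b → mu i a / mu i b ≤ kappa := by
    intro i a b ha hb
    rw [hkappa]
    exact le_ciSup (f := fun p : {p : I × J × J // E p.1 p.2.1 ∧ E p.1 p.2.2} =>
        mu p.1.1 p.1.2.1 / mu p.1.1 p.1.2.2)
      (Set.finite_range _).bddAbove ⟨(i, a, b), ha, hb⟩
  have hkpos : 0 < kappa := by
    obtain ⟨i, hi⟩ := hEj j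
    exact lt_of_lt_of_le (div_pos (hmu i j hi) (hmu i j hi)) (hk i j j hi hi)
  have key : (1 / kappa) *
        ((∑ i ∈ univ.filter (fun i => E i j),
          x i j / (1 - ∑ l ∈ univ.filter (fun l => E i l), x i l * lam l / mui i)) - 1)
      = ∑ i ∈ univ.filter (fun i => E i j), x i j * ((1 / kappa) *
        ((∑ l ∈ univ.filter (fun l => E i l), x i l * lam l / mui i) /
          (1 - ∑ l ∈ univ.filter (fun l => E i l), x i l * lam l / mui i))) := by
    have hsub : ∀ a : ℝ, a - 1 = a - ∑ i ∈ univ.filter (fun i => E i j), x i j := by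
      intro a
      rw [hxj]
    rw [hsub, ← Finset.sum_sub_distrib, Finset.mul_sum]
    refine Finset.sum_congr rfl fun i _ => ?_
    have h : (1 - ∑ l ∈ univ.filter (fun l => E i l), x i l * lam l / mui i) ≠ 0 := by
      have := hrhobar i
      linarith
    generalize (∑ l ∈ univ.filter (fun l => E i l), x i l * lam l / mui i) = r at h ⊢
    field_simp
    ring
  rw [ge_iff_le, key]
  unfold wbar
  refine Finset.sum_le_sum fun i hi => ?_
  have hij : E i j := (Finset.mem_filter.mp hi).2
  have hmij := hmu i j hij
  rw [mul_assoc]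
  refine mul_le_mul_of_nonneg_left ?_ (hx01 i j).1
  rw [← mul_div_assoc, ← mul_div_assoc]
  have hri := hrho i
  unfold rho at hri
  refine div_le_div₀ ?_ ?_ (by linarith) ?_
  · refine mul_nonneg hmij.le (Finset.sum_nonneg fun l hl => ?_)
    exact div_nonneg (mul_nonneg (hx01 i l).1 (hlam l).le) (sq_nonneg _)
  · rw [Finset.mul_sum, Finset.mul_sum]
    refine Finset.sum_le_sum fun l hl => ?_
    have hil : E i l := (Finset.mem_filter.mp hl).2
    have hml := hmu i l hil
    have h1 := hk i l j hil hij
    rw [div_le_iff₀ hmij] at h1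
    have h2 := hle i l hil
    have hmi : 0 < mui i := lt_of_lt_of_le hml h2
    have h3 : 1 / kappa * (1 / mui i) ≤ mu i j * (1 / mu i l ^ 2) := by
      rw [← mul_div_assoc, ← mul_div_assoc, mul_one, mul_one, div_div,
        div_le_div_iff₀ (by positivity) (by positivity)]
      nlinarith [mul_le_mul h1 h2 hml.le (by positivity)]
    have h4 : 0 ≤ x i l * lam l := mul_nonneg (hx01 i l).1 (hlam l).le
    calc 1 / kappa * (x i l * lam l / mui i)
        = (x i l * lam l) * (1 / kappa * (1 / mui i)) := by ring
      _ ≤ (x i l * lam l) * (mu i j * (1 / mu i l ^ 2)) := mul_le_mul_of_nonneg_left h3 h4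
      _ = _ := by ring
  · refine sub_le_sub_left (Finset.sum_le_sum fun l hl => ?_) 1
    have hil : E i l := (Finset.mem_filter.mp hl).2
    exact div_le_div_of_nonneg_left (mul_nonneg (hx01 i l).1 (hlam l).le) (hmu i l hil)
      (hle i l hil)
end
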